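/- arXiv:1206.6114 — 3 statements merged into one kernel-verified Lean document; each statement's English description precedes it below -/
import Mathlib

section
/- Let Γ(ρ) := p(0) + ∑_{ℓ≥1} p(ℓ+1) ℓ² e^{ρℓ} and β := sup{ρ > 0 : ρΓ(ρ) ≤ v}. Then for every 0 < ρ < min{β, σ'} and every x ∈ ℕ, the reflected Galton-Watson generator satisfies Q̃(e^{ρ·})(x) ≤ −(vρ/2) e^{ρx} + e^{ρ}. -/
open MeasureTheory Filter Topology Set

noncomputable section

/-- Jump rates of the continuous-time Galton-Watson process: from `x ≥ 1`,
jump to `x - 1` at rate `x p(0)` and to `y > x` at rate `x p(y - x + 1)`;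
the state `0` is absorbing. -/
def gwRate (p : ℕ → ℝ) (x y : ℕ) : ℝ :=
  if 1 ≤ x ∧ y + 1 = x then (x : ℝ) * p 0
  else if 1 ≤ x ∧ x < y then (x : ℝ) * p (y - x + 1)
  else 0

/-- The offspring law: a probability on ℕ with a finite positive exponential
moment and negative (subcritical) drift `-v = ∑_{ℓ ≥ -1} ℓ p(ℓ+1) < 0`. -/
structure OffspringLaw (p : ℕ → ℝ) (σ v : ℝ) : Prop where
  nonneg : ∀ k, 0 ≤ p k
  total : ∑' k : ℕ, p k = 1
  sigma_pos : 0 < σ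
  expMoment : Summable fun k : ℕ => p k * Real.exp (σ * k)
  v_pos : 0 < v
  drift : ∑' k : ℕ, ((k : ℝ) - 1) * p k = -v

/-- Empirical distribution of an `N`-particle configuration. -/
def emp (N : ℕ) (x : ℕ) (ξ : Fin N → ℕ) : ℝ :=
  (N : ℝ)⁻¹ * ∑ i : Fin N, (if ξ i = x then (1 : ℝ) else 0)

/-- Fleming-Viot generator for general driving rates `q`. -/
def fvGenQ (q : ℕ → ℕ → ℝ) (N : ℕ) (f : (Fin N → ℕ) → ℝ) (ξ : Fin N → ℕ) : ℝ :=
  ∑ i : Fin N, ∑' y : ℕ,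
    (if 1 ≤ y then
        q (ξ i) y + q (ξ i) 0 * ((N : ℝ) / ((N : ℝ) - 1)) * emp N y ξ
      else 0) * (f (Function.update ξ i y) - f ξ)

/-- Fleming-Viot generator driven by the Galton-Watson rates. -/
def fvGen (p : ℕ → ℝ) (N : ℕ) : ((Fin N → ℕ) → ℝ) → (Fin N → ℕ) → ℝ :=
  fvGenQ (gwRate p) N

/-- Bounded real observables. -/
def Bounded {S : Type*} (f : S → ℝ) : Prop := ∃ C, ∀ x, |f x| ≤ C

/-- A Markov transition semigroup on a measurable state space. -/
structure MarkovSemigroup (S : Type*) [MeasurableSpace S] where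
  P : ℝ → S → Measure S
  meas : ∀ t, Measurable (P t)
  prob : ∀ t x, IsProbabilityMeasure (P t x)
  init : ∀ x, P 0 x = Measure.dirac x
  semigroup : ∀ s t : ℝ, 0 ≤ s → 0 ≤ t → ∀ x, P (s + t) x = (P s x).bind (P t)

/-- `K` is the transition semigroup of the `N`-particle Fleming-Viot process
driven by the rates `q`: it solves the Kolmogorov equation for the
Fleming-Viot generator on bounded observables. -/
def IsFVQSemigroup (q : ℕ → ℕ → ℝ) (N : ℕ) (K : MarkovSemigroup (Fin N → ℕ)) : Prop :=
  ∀ f : (Fin N → ℕ) → ℝ, Bounded f → Measurable f → ∀ ξ, ∀ t : ℝ, 0 ≤ t →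
    HasDerivWithinAt (fun u => ∫ η, f η ∂ K.P u ξ)
      (∫ η, fvGenQ q N f η ∂ K.P t ξ) (Set.Ici 0) t

/-- `K` is the `N`-particle Fleming-Viot semigroup driven by Galton-Watson. -/
def IsFVSemigroup (p : ℕ → ℝ) (N : ℕ) (K : MarkovSemigroup (Fin N → ℕ)) : Prop :=
  IsFVQSemigroup (gwRate p) N K

/-- Invariant (stationary) measure of a Markov semigroup. -/
def Invariant {S : Type*} [MeasurableSpace S] (K : MarkovSemigroup S) (μ : Measure S) : Prop :=
  ∀ t : ℝ, 0 ≤ t → μ.bind (K.P t) = μ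

/-- Transition probabilities of the Galton-Watson process (absorbed at 0),
characterized by the Kolmogorov backward equations. -/
structure GWTransition (p : ℕ → ℝ) where
  pt : ℝ → ℕ → ℕ → ℝ
  nonneg : ∀ t x y, 0 ≤ pt t x y
  total : ∀ t x, 0 ≤ t → ∑' y : ℕ, pt t x y = 1
  init : ∀ x y, pt 0 x y = if y = x then 1 else 0
  backward : ∀ x y, ∀ t : ℝ, 0 ≤ t →
    HasDerivWithinAt (fun s => pt s x y)
      (∑' z : ℕ, gwRate p x z * (pt t z y - pt t x y)) (Set.Ici 0) t

/-- The law at time `t` of the process started from `μ`, conditioned on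
non-absorption up to time `t`. -/
def condLaw (pt : ℝ → ℕ → ℕ → ℝ) (μ : ℕ → ℝ) (t : ℝ) (y : ℕ) : ℝ :=
  (∑' x : ℕ, μ x * pt t x y) /
    ∑' x : ℕ, ∑' z : ℕ, (if 1 ≤ z then μ x * pt t x z else 0)

def diracOne : ℕ → ℝ := fun x => if x = 1 then 1 else 0

/-- `ν` is the Yaglom limit (the minimal quasi-stationary distribution). -/
def IsYaglomLimit (pt : ℝ → ℕ → ℕ → ℝ) (ν : ℕ → ℝ) : Prop :=
  ∀ y : ℕ, Tendsto (fun t => condLaw pt diracOne t y) atTop (𝓝 (ν y))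

/-- Position of the rightmost particle. -/
def rmax (N : ℕ) (ξ : Fin N → ℕ) : ℕ := Finset.univ.sup ξ

/-- Ratio of the second to the first empirical moment. -/
def psiFun (N : ℕ) (ξ : Fin N → ℕ) : ℝ :=
  (∑ i : Fin N, (ξ i : ℝ) ^ 2) / ∑ i : Fin N, (ξ i : ℝ)

/-- Configurations of the multitype branching process: `ζ (i, x)` is the
number of type-`i` individuals at site `x`. -/
abbrev BConf (N : ℕ) := Fin N × ℕ → ℕ

/-- Total number of individuals. -/
def bTotal (N : ℕ) (ζ : BConf N) : ENNReal := ∑' w : Fin N × ℕ, (ζ w : ENNReal)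

/-- Rightmost occupied site. -/
def bRmax (N : ℕ) (ζ : BConf N) : ℕ := sSup {x : ℕ | ∃ i, ζ (i, x) ≠ 0}

/-- Move one type-`i` individual from `x` to `y`. -/
def bJump (N : ℕ) (ζ : BConf N) (i : Fin N) (x y : ℕ) : BConf N :=
  fun w => if w = (i, x) then ζ w - 1 else if w = (i, y) then ζ w + 1 else ζ w

/-- Every type-`j` individual gives birth to a type-`i` individual at its own
position. -/
def bBranch (N : ℕ) (ζ : BConf N) (i j : Fin N) : BConf N :=
  fun w => if w.1 = i then ζ w + ζ (j, w.2) else ζ w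

/-- Generator of the multitype branching Markov process. -/
def branchGen (q : ℕ → ℕ → ℝ) (qbar : ℝ) (N : ℕ) (f : BConf N → ℝ) (ζ : BConf N) : ℝ :=
  (∑' w : (Fin N × ℕ) × ℕ,
      (ζ w.1 : ℝ) * (if w.2 ≠ 0 ∧ w.2 ≠ w.1.2 then q w.1.2 w.2 else 0) *
        (f (bJump N ζ w.1.1 w.1.2 w.2) - f ζ))
    + ∑ i : Fin N, ∑ j : Fin N,
        (if j ≠ i then qbar / ((N : ℝ) - 1) * (f (bBranch N ζ i j) - f ζ) else 0)

def IsBranchSemigroup (q : ℕ → ℕ → ℝ) (qbar : ℝ) (N : ℕ)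
    (B : MarkovSemigroup (BConf N)) : Prop :=
  ∀ f : BConf N → ℝ, Bounded f → Measurable f → ∀ ζ, ∀ t : ℝ, 0 ≤ t →
    HasDerivWithinAt (fun u => ∫ η, f η ∂ B.P u ζ)
      (∫ η, branchGen q qbar N f η ∂ B.P t ζ) (Set.Ici 0) t

/-- Generator of the single-particle motion with jumps to `0` suppressed. -/
def tildeGen (q : ℕ → ℕ → ℝ) (f : ℕ → ℝ) (x : ℕ) : ℝ :=
  ∑' y : ℕ, (if y ≠ 0 ∧ y ≠ x then q x y else 0) * (f y - f x)

def IsTildeSemigroup (q : ℕ → ℕ → ℝ) (T : MarkovSemigroup ℕ) : Prop :=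
  ∀ f : ℕ → ℝ, Bounded f → ∀ x, ∀ t : ℝ, 0 ≤ t →
    HasDerivWithinAt (fun u => ∫ y, f y ∂ T.P u x)
      (∫ y, tildeGen q f y ∂ T.P t x) (Set.Ici 0) t

/-- Generator of the Galton-Watson process together with its cumulative birth
counter: from `(z, b)`, jump to `(z + k - 1, b + k)` at rate `z p(k)`. -/
def gwbGen (p : ℕ → ℝ) (f : ℕ × ℕ → ℝ) (w : ℕ × ℕ) : ℝ :=
  ∑' k : ℕ, (w.1 : ℝ) * p k * (f (w.1 + k - 1, w.2 + k) - f w)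

def IsGWBSemigroup (p : ℕ → ℝ) (W : MarkovSemigroup (ℕ × ℕ)) : Prop :=
  ∀ f : ℕ × ℕ → ℝ, Bounded f → ∀ w, ∀ t : ℝ, 0 ≤ t →
    HasDerivWithinAt (fun u => ∫ z, f z ∂ W.P u w)
      (∫ z, gwbGen p f z ∂ W.P t w) (Set.Ici 0) t

/-- `E[exp(σ' H¹)] < ∞`, where `H¹ = 1 + (total number of births)` of the
Galton-Watson process started from one individual; the total number of births
is the increasing limit of the birth counter. -/
def HMomentFinite (W : MarkovSemigroup (ℕ × ℕ)) (σ' : ℝ) : Prop :=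
  ∃ M : ℝ, ∀ t : ℝ, 0 ≤ t →
    ∫⁻ w, ENNReal.ofReal (Real.exp (σ' * (1 + (w.2 : ℝ)))) ∂ W.P t (1, 0)
      ≤ ENNReal.ofReal M

/-- The class `F` of test functions: `∑_ℓ e^{-ρℓ} |f(ℓ)| < ∞` for some `ρ < σ'`. -/
def MemF (σ' : ℝ) (f : ℕ → ℝ) : Prop :=
  ∃ ρ : ℝ, ρ < σ' ∧ Summable fun ℓ : ℕ => Real.exp (-ρ * ℓ) * |f ℓ|

/-- Galton-Watson semigroup `S_t f(x) = E f(Z^x_t)`, read off from the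
birth-counting process. -/
def gwS (W : MarkovSemigroup (ℕ × ℕ)) (t : ℝ) (f : ℕ → ℝ) (x : ℕ) : ℝ :=
  ∫ w, f w.1 ∂ W.P t (x, 0)

/-- Galton-Watson generator `Q f(x) = ∑_{ℓ ≥ -1} x p(ℓ+1) (f(x+ℓ) - f(x))`. -/
def gwQ (p : ℕ → ℝ) (f : ℕ → ℝ) (x : ℕ) : ℝ :=
  ∑' k : ℕ, (x : ℝ) * p k * (f (x + k - 1) - f x)

/-- Reflected Galton-Watson generator
`Q̃ f(x) = ∑_{ℓ ≥ -1} x p(ℓ+1) 1{x+ℓ ≥ 1} (f(x+ℓ) - f(x))`. -/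
def gwQRefl (p : ℕ → ℝ) (f : ℕ → ℝ) (x : ℕ) : ℝ :=
  ∑' k : ℕ, (x : ℝ) * p k * (if 1 ≤ x + k - 1 then f (x + k - 1) - f x else 0)

def IsReflSemigroup (p : ℕ → ℝ) (R : MarkovSemigroup ℕ) : Prop :=
  ∀ f : ℕ → ℝ, Bounded f → ∀ x, ∀ t : ℝ, 0 ≤ t →
    HasDerivWithinAt (fun u => ∫ y, f y ∂ R.P u x)
      (∫ y, gwQRefl p f y ∂ R.P t x) (Set.Ici 0) t

/-- `Γ(ρ) = p(0) + ∑_{ℓ ≥ 1} p(ℓ+1) ℓ² e^{ρℓ}`. -/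
def gwGamma (p : ℕ → ℝ) (ρ : ℝ) : ℝ :=
  p 0 + ∑' ℓ : ℕ, p (ℓ + 2) * ((ℓ : ℝ) + 1) ^ 2 * Real.exp (ρ * ((ℓ : ℝ) + 1))

/-- `β = sup {ρ > 0 : ρ Γ(ρ) ≤ v}`. -/
def gwBeta (p : ℕ → ℝ) (v : ℝ) : ℝ :=
  sSup {ρ : ℝ | 0 < ρ ∧ ρ * gwGamma p ρ ≤ v}

/-- Generating function `G(μ; z) = ∑_x μ(x) z^x`. -/
def genFn (μ : ℕ → ℝ) (z : ℝ) : ℝ := ∑' x : ℕ, μ x * z ^ x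

/-- A probability distribution on the positive integers. -/
def IsProbOnPos (μ : ℕ → ℝ) : Prop :=
  (∀ x, 0 ≤ μ x) ∧ μ 0 = 0 ∧ ∑' x : ℕ, μ x = 1

/-- The class `K(α)`: probabilities on ℕ whose second-to-first moment ratio
is at most `α`. -/
def InK (α : ℝ) (μ : ℕ → ℝ) : Prop :=
  IsProbOnPos μ ∧ (Summable fun x : ℕ => (x : ℝ) ^ 2 * μ x) ∧
    (∑' x : ℕ, (x : ℝ) ^ 2 * μ x) ≤ α * ∑' x : ℕ, (x : ℝ) * μ x


/-- A function on `[0, T]` whose right derivative is at least `c` grows at least linearly. -/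
lemma add_mul_le_of_le_deriv {u u' : ℝ → ℝ} {c T : ℝ} (hT : 0 ≤ T)
    (hu : ∀ t, 0 ≤ t → HasDerivWithinAt u (u' t) (Set.Ici 0) t)
    (hc : ∀ t, 0 ≤ t → t ≤ T → c ≤ u' t) : u 0 + c * T ≤ u T := by
  have hcont : ContinuousOn u (Set.Icc 0 T) := fun t ht =>
    (hu t ht.1).continuousWithinAt.mono Set.Icc_subset_Ici_self
  have hder : ∀ t ∈ interior (Set.Icc 0 T), HasDerivAt u (u' t) t := by
    intro t ht
    rw [interior_Icc] at ht
    exact (hu t ht.1.le).hasDerivAt (Ici_mem_nhds ht.1)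
  have h := (convex_Icc (0 : ℝ) T).mul_sub_le_image_sub_of_le_deriv hcont
    (fun t ht => (hder t ht).differentiableAt.differentiableWithinAt) (C := c)
    (fun t ht => by
      rw [(hder t ht).deriv]
      have := interior_subset ht
      exact hc t this.1 this.2) 0 ⟨le_rfl, hT⟩ T ⟨hT, le_rfl⟩ hT
  linarith

/-- A bounded solution of `u' ≥ δ u - ε` with `δ > 0` starts below `ε / δ`. -/
lemma mul_le_of_bounded_of_le_deriv {u u' : ℝ → ℝ} {δ ε B : ℝ} (hδ : 0 < δ)
    (hu : ∀ t, 0 ≤ t → HasDerivWithinAt u (u' t) (Set.Ici 0) t)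
    (hc : ∀ t, 0 ≤ t → δ * u t - ε ≤ u' t) (hB : ∀ t, 0 ≤ t → u t ≤ B) :
    δ * u 0 ≤ ε := by
  by_contra! hlt
  have hgrow : ∀ T, 0 ≤ T → u 0 - ε / δ ≤ Real.exp (-δ * T) * (u T - ε / δ) := by
    intro T hT
    have h := add_mul_le_of_le_deriv (u := fun t => Real.exp (-δ * t) * (u t - ε / δ))
      (u' := fun t => Real.exp (-δ * t) * (-δ) * (u t - ε / δ) + Real.exp (-δ * t) * u' t)
      (c := 0) hT
      (fun t ht => by
        have h1 : HasDerivAt (fun t : ℝ => Real.exp (-δ * t)) (Real.exp (-δ * t) * (-δ)) t := by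
          simpa using ((hasDerivAt_id t).const_mul (-δ)).exp
        exact h1.hasDerivWithinAt.mul ((hu t ht).sub_const _))
      (fun t ht _ => by
        have h1 := hc t ht
        have h2 : δ * (ε / δ) = ε := by field_simp
        have h3 : Real.exp (-δ * t) * (-δ) * (u t - ε / δ) + Real.exp (-δ * t) * u' t
            = Real.exp (-δ * t) * (u' t - (δ * u t - δ * (ε / δ))) := by ring
        rw [h3, h2]
        exact mul_nonneg (Real.exp_pos _).le (by linarith))
    simpa using h
  have hpos : 0 < u 0 - ε / δ := by
    rw [sub_pos, div_lt_iff₀ hδ]; linarith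
  have hlim : Tendsto (fun T : ℝ => Real.exp (-δ * T) * (B - ε / δ)) atTop (𝓝 0) := by
    have h1 : Tendsto (fun T : ℝ => -δ * T) atTop atBot :=
      tendsto_id.const_mul_atTop_of_neg (by linarith)
    simpa using (Real.tendsto_exp_atBot.comp h1).mul_const (B - ε / δ)
  obtain ⟨T, hT1, hT2⟩ := ((hlim.eventually (gt_mem_nhds hpos)).and (eventually_ge_atTop 0)).exists
  have h1 := hgrow T hT2
  have h2 := mul_le_mul_of_nonneg_left (sub_le_sub_right (hB T hT2) (ε / δ))
    (Real.exp_pos (-δ * T)).le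
  linarith

/-- Exponentials dominate squares, uniformly far out. -/
lemma exists_sq_mul_exp_le {ρ r ε : ℝ} (h : ρ < r) (hε : 0 < ε) :
    ∃ n : ℕ, ∀ m : ℕ, n ≤ m →
      ((m : ℝ) + 1) ^ 2 * Real.exp (ρ * m) ≤ ε * Real.exp (r * m) := by
  have h1 : Tendsto (fun y : ℝ => y ^ 2 * Real.exp (-(r - ρ) * y)) atTop (𝓝 0) := by
    have := tendsto_rpow_mul_exp_neg_mul_atTop_nhds_zero 2 (r - ρ) (sub_pos.2 h)
    simpa using this
  have h2 : Tendsto (fun m : ℕ => (m : ℝ) + 1) atTop atTop :=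
    tendsto_atTop_add_const_right _ _ tendsto_natCast_atTop_atTop
  have hε' : 0 < ε * Real.exp (-(r - ρ)) := by positivity
  obtain ⟨n, hn⟩ := eventually_atTop.1 ((h1.comp h2).eventually (gt_mem_nhds hε'))
  refine ⟨n, fun m hm => ?_⟩
  have h3 := (hn m hm).le
  simp only [Function.comp] at h3
  have e1 : Real.exp (-(r - ρ) * ((m : ℝ) + 1))
      = Real.exp (-(r - ρ)) * (Real.exp (ρ * m) * Real.exp (-(r * m))) := by
    rw [← Real.exp_add, ← Real.exp_add]; ring_nf
  rw [e1] at h3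
  have h4 : ((m : ℝ) + 1) ^ 2 * (Real.exp (ρ * m) * Real.exp (-(r * m))) ≤ ε := by
    have := Real.exp_pos (-(r - ρ))
    nlinarith
  calc ((m : ℝ) + 1) ^ 2 * Real.exp (ρ * m)
      = ((m : ℝ) + 1) ^ 2 * (Real.exp (ρ * m) * Real.exp (-(r * m))) * Real.exp (r * m) := by
        rw [Real.exp_neg]; field_simp
    _ ≤ ε * Real.exp (r * m) := mul_le_mul_of_nonneg_right h4 (Real.exp_pos _).le

/-- Exponentials dominate squares up to a constant. -/
lemma exists_sq_mul_exp_le_const {ρ r : ℝ} (h : ρ < r) :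
    ∃ C : ℝ, 0 ≤ C ∧ ∀ m : ℕ,
      ((m : ℝ) + 1) ^ 2 * Real.exp (ρ * m) ≤ C * Real.exp (r * m) := by
  obtain ⟨n, hn⟩ := exists_sq_mul_exp_le h one_pos
  refine ⟨1 + ∑ j ∈ Finset.range n, ((j : ℝ) + 1) ^ 2 * Real.exp (ρ * j) * Real.exp (-(r * j)),
    by positivity, fun m => ?_⟩
  by_cases hm : n ≤ m
  · refine (hn m hm).trans (mul_le_mul_of_nonneg_right ?_ (Real.exp_pos _).le)
    have : 0 ≤ ∑ j ∈ Finset.range n,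
      ((j : ℝ) + 1) ^ 2 * Real.exp (ρ * j) * Real.exp (-(r * j)) := by positivity
    linarith
  · have h1 := Finset.single_le_sum
      (f := fun j : ℕ => ((j : ℝ) + 1) ^ 2 * Real.exp (ρ * j) * Real.exp (-(r * j)))
      (fun j _ => by positivity) (Finset.mem_range.2 (not_le.1 hm))
    calc ((m : ℝ) + 1) ^ 2 * Real.exp (ρ * m)
        = ((m : ℝ) + 1) ^ 2 * Real.exp (ρ * m) * Real.exp (-(r * m)) * Real.exp (r * m) := by
          rw [Real.exp_neg]; field_simp
      _ ≤ _ := mul_le_mul_of_nonneg_right (by linarith) (Real.exp_pos _).le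

namespace OffspringLaw

variable {p : ℕ → ℝ} {σ v : ℝ}

lemma summable (hp : OffspringLaw p σ v) : Summable p := by
  by_contra h
  have := hp.total
  rw [tsum_eq_zero_of_not_summable h] at this
  exact zero_ne_one this

lemma summable_drift (hp : OffspringLaw p σ v) : Summable fun k : ℕ => ((k : ℝ) - 1) * p k := by
  by_contra h
  have h1 := hp.drift
  rw [tsum_eq_zero_of_not_summable h] at h1
  linarith [hp.v_pos]

lemma v_le (hp : OffspringLaw p σ v) : v ≤ p 0 := by
  have h := hp.summable_drift
  have h1 := h.tsum_eq_zero_add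
  rw [hp.drift] at h1
  have h2 : 0 ≤ ∑' k : ℕ, (((k + 1 : ℕ) : ℝ) - 1) * p (k + 1) :=
    tsum_nonneg fun k => mul_nonneg (by push_cast; linarith [k.cast_nonneg (α := ℝ)])
      (hp.nonneg _)
  simp only [Nat.cast_zero] at h1
  linarith

lemma p_zero_le_one (hp : OffspringLaw p σ v) : p 0 ≤ 1 := by
  rw [← hp.total]
  exact hp.summable.le_tsum 0 fun k _ => hp.nonneg k

end OffspringLaw

/-- Any exponent below `gwBeta` is less than one, whether or not the series defining
`gwGamma` converges. -/
lemma lt_one_of_lt_gwBeta {p : ℕ → ℝ} {σ v : ℝ} (hp : OffspringLaw p σ v) {ρ : ℝ}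
    (hρ : ρ < gwBeta p v) : ρ < 1 := by
  refine hρ.trans_le (Real.sSup_le ?_ zero_le_one)
  rintro r ⟨hr0, hr⟩
  have h1 : p 0 ≤ gwGamma p r := by
    have : 0 ≤ ∑' ℓ : ℕ, p (ℓ + 2) * ((ℓ : ℝ) + 1) ^ 2 * Real.exp (r * ((ℓ : ℝ) + 1)) :=
      tsum_nonneg fun k => mul_nonneg (mul_nonneg (hp.nonneg _) (by positivity))
        (Real.exp_pos _).le
    unfold gwGamma
    linarith
  have h2 := hp.v_le
  have h3 := hp.v_pos
  by_contra! h
  nlinarith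

/-- The trapezoidal bound for the exponential. -/
lemma exp_sub_one_le_trapezoid {u : ℝ} (hu : 0 ≤ u) :
    Real.exp u - 1 ≤ u * (Real.exp u + 1) / 2 := by
  have h := add_mul_le_of_le_deriv (u := fun t => 2 + t - (2 - t) * Real.exp t)
    (u' := fun t => 1 - ((-1) * Real.exp t + (2 - t) * Real.exp t)) (c := 0) hu
    (fun t _ => (((hasDerivAt_id t).const_add 2).sub
      (((hasDerivAt_id t).const_sub 2).mul (Real.hasDerivAt_exp t))).hasDerivWithinAt)
    (fun t _ _ => by
      have h1 := Real.add_one_le_exp (-t)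
      have h2 : Real.exp (-t) * Real.exp t = 1 := by rw [← Real.exp_add]; simp
      have h3 := Real.exp_pos t
      nlinarith)
  simp at h
  linarith

/-- The pointwise inequality behind the drift bound. -/
lemma exp_jump_le {ρ : ℝ} (hρ0 : 0 < ρ) (hρ1 : ρ ≤ 1) (k : ℕ) :
    Real.exp (ρ * ((k : ℝ) - 1)) - 1 ≤ (1 / 2 - ρ / 4) * ρ * ((k : ℝ) - 1)
      + Real.exp (-ρ) / 2 * ρ * (k * Real.exp (ρ * k) - 1) := by
  have hE : Real.exp (-ρ) * Real.exp ρ = 1 := by rw [← Real.exp_add]; simp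
  have hpos := Real.exp_pos (-ρ)
  have hle : Real.exp (-ρ) ≤ 1 := Real.exp_le_one_iff.2 (by linarith)
  rcases k with _ | k
  · have hq := Real.quadratic_le_exp_of_nonneg hρ0.le
    have h1 : Real.exp (-ρ) * (1 + ρ / 2) ≤ 1 - ρ / 2 + ρ ^ 2 / 4 := by
      have h2 : 1 + ρ / 2 ≤ (1 - ρ / 2 + ρ ^ 2 / 4) * Real.exp ρ := by
        have h3 : 0 ≤ 1 - ρ / 2 + ρ ^ 2 / 4 := by nlinarith
        have h4 := mul_le_mul_of_nonneg_left hq h3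
        have h5 : 0 ≤ ρ ^ 3 := by positivity
        have h6 : 0 ≤ ρ ^ 4 := by positivity
        have h7 : 0 ≤ ρ ^ 2 * (1 - ρ) := mul_nonneg (sq_nonneg _) (by linarith)
        nlinarith
      calc Real.exp (-ρ) * (1 + ρ / 2)
          ≤ Real.exp (-ρ) * ((1 - ρ / 2 + ρ ^ 2 / 4) * Real.exp ρ) :=
            mul_le_mul_of_nonneg_left h2 hpos.le
        _ = (1 - ρ / 2 + ρ ^ 2 / 4) * (Real.exp (-ρ) * Real.exp ρ) := by ring
        _ = _ := by rw [hE, mul_one]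
    have e : ρ * (((0 : ℕ) : ℝ) - 1) = -ρ := by simp
    rw [e]
    simp only [Nat.cast_zero]
    linarith
  · have hk : (0 : ℝ) ≤ k := k.cast_nonneg
    have e1 : ρ * (((k + 1 : ℕ) : ℝ) - 1) = ρ * k := by push_cast; ring
    have e2 : Real.exp (ρ * ((k + 1 : ℕ) : ℝ)) = Real.exp (ρ * k) * Real.exp ρ := by
      rw [← Real.exp_add]; push_cast; ring_nf
    have h1 := exp_sub_one_le_trapezoid (mul_nonneg hρ0.le hk)
    have h2 := Real.add_one_le_exp (ρ * k)
    rw [e1, e2]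
    have e3 : Real.exp (-ρ) / 2 * ρ
        * (((k + 1 : ℕ) : ℝ) * (Real.exp (ρ * k) * Real.exp ρ) - 1)
        = ρ / 2 * ((k + 1) * Real.exp (ρ * k) * (Real.exp (-ρ) * Real.exp ρ)
          - Real.exp (-ρ)) := by
      push_cast; ring
    rw [e3, hE]
    push_cast
    have h3 : 0 ≤ ρ * (Real.exp (ρ * k) - Real.exp (-ρ) - ρ * k) :=
      mul_nonneg hρ0.le (by linarith)
    have h4 : 0 ≤ ρ * ρ * k := by positivity
    nlinarith

/-- A function on a countable discrete space with finite support is integrable. -/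
lemma integrable_of_support_finite {μ : Measure (ℕ × ℕ)} [IsProbabilityMeasure μ]
    {f : ℕ × ℕ → ℝ} (hf : f.support.Finite) : Integrable f μ := by
  obtain ⟨C, hC⟩ := (hf.image fun w => ‖f w‖).bddAbove
  refine Integrable.of_bound (measurable_of_countable f).aestronglyMeasurable (max C 0)
    (ae_of_all _ fun w => ?_)
  by_cases hw : f w = 0
  · simp [hw]
  · exact (hC ⟨w, hw, rfl⟩).trans (le_max_left _ _)

lemma bounded_of_support_finite {f : ℕ × ℕ → ℝ} (hf : f.support.Finite) : Bounded f := by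
  obtain ⟨C, hC⟩ := (hf.image fun w => |f w|).bddAbove
  refine ⟨max C 0, fun w => ?_⟩
  by_cases hw : f w = 0
  · simp [hw]
  · exact (hC ⟨w, hw, rfl⟩).trans (le_max_left _ _)

/-- A function supported in a bounded range of birth counts `b`, at populations `z ≤ b + 1`,
has a generator image of finite support. -/
lemma support_gwbGen_finite {p : ℕ → ℝ} {f : ℕ × ℕ → ℝ} {n : ℕ}
    (hf : ∀ w : ℕ × ℕ, f w ≠ 0 → w.1 ≤ w.2 + 1 ∧ w.2 < n) : (gwbGen p f).support.Finite := by
  refine ((Set.finite_Iic (n + 2)).prod (Set.finite_Iic n)).subset ?_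
  rintro ⟨z, b⟩ hw
  by_contra hout
  refine hw ?_
  have h0 : ∀ w : ℕ × ℕ, ¬ (w.1 ≤ w.2 + 1 ∧ w.2 < n) → f w = 0 := fun w h => by
    by_contra h'; exact h (hf w h')
  have hout' : ¬ (z ≤ n + 2 ∧ b ≤ n) := by simpa using hout
  unfold gwbGen
  have hz : ∀ k : ℕ, f (z + k - 1, b + k) - f (z, b) = 0 := by
    intro k
    rw [h0, h0, sub_zero]
    · simp only; omega
    · simp only; omega
  simp [hz]

lemma support_finite_of_le {f : ℕ × ℕ → ℝ} {n : ℕ}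
    (hf : ∀ w : ℕ × ℕ, f w ≠ 0 → w.1 ≤ w.2 + 1 ∧ w.2 < n) : f.support.Finite := by
  refine ((Set.finite_Iic n).prod (Set.finite_Iio n)).subset ?_
  intro w hw
  obtain ⟨h1, h2⟩ := hf w hw
  simp only [Set.mem_prod, Set.mem_Iic, Set.mem_Iio]
  omega

lemma summable_gwbGen {p : ℕ → ℝ} {σ v : ℝ} (hp : OffspringLaw p σ v) {f : ℕ × ℕ → ℝ}
    (hf : Bounded f) (w : ℕ × ℕ) :
    Summable fun k : ℕ => (w.1 : ℝ) * p k * (f (w.1 + k - 1, w.2 + k) - f w) := by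
  obtain ⟨C, hC⟩ := hf
  refine Summable.of_norm_bounded (hp.summable.mul_left ((w.1 : ℝ) * (C + C))) fun k => ?_
  rw [Real.norm_eq_abs, abs_mul, abs_of_nonneg (mul_nonneg w.1.cast_nonneg (hp.nonneg k))]
  have h1 := (abs_sub (f (w.1 + k - 1, w.2 + k)) (f w)).trans (add_le_add (hC _) (hC _))
  have h2 := mul_le_mul_of_nonneg_left h1 (mul_nonneg (w.1.cast_nonneg (α := ℝ)) (hp.nonneg k))
  linarith

/-- A nonnegative function loses mass at `w` at rate at most `w.1`, and gains at least what a
finite set of jumps brings. -/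
lemma le_gwbGen_of_nonneg {p : ℕ → ℝ} {σ v : ℝ} (hp : OffspringLaw p σ v) {f : ℕ × ℕ → ℝ}
    (hf : Bounded f) (hf0 : ∀ w, 0 ≤ f w) (w : ℕ × ℕ) (s : Finset ℕ) :
    (w.1 : ℝ) * ∑ k ∈ s, p k * f (w.1 + k - 1, w.2 + k) - w.1 * f w ≤ gwbGen p f w := by
  have h1 := summable_gwbGen hp hf w
  have h2 : Summable fun k : ℕ => (w.1 : ℝ) * f w * p k := hp.summable.mul_left _
  have h3 : gwbGen p f w + w.1 * f w
      = ∑' k : ℕ, (w.1 : ℝ) * p k * f (w.1 + k - 1, w.2 + k) := by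
    have e : (w.1 : ℝ) * f w = ∑' k : ℕ, (w.1 : ℝ) * f w * p k := by
      rw [tsum_mul_left, hp.total, mul_one]
    rw [e, gwbGen, ← h1.tsum_add h2]
    exact tsum_congr fun k => by ring
  have h4 : Summable fun k : ℕ => (w.1 : ℝ) * p k * f (w.1 + k - 1, w.2 + k) :=
    (h1.add h2).congr fun k => by ring
  have h5 := h4.sum_le_tsum s fun k _ =>
    mul_nonneg (mul_nonneg w.1.cast_nonneg (hp.nonneg k)) (hf0 _)
  rw [← h3] at h5
  rw [Finset.mul_sum]
  simp only [← mul_assoc]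
  linarith

/-- The exponential moments of the birth counter, below the given one. -/
lemma HMomentFinite.exists_integral_le {W : MarkovSemigroup (ℕ × ℕ)} {σ' : ℝ} (hσ' : 0 < σ')
    (hH : HMomentFinite W σ') : ∃ M : ℝ, 0 < M ∧ ∀ t : ℝ, 0 ≤ t →
      Integrable (fun w : ℕ × ℕ => Real.exp (σ' * (w.2 : ℝ))) (W.P t (1, 0)) ∧
      ∫ w, Real.exp (σ' * (w.2 : ℝ)) ∂ W.P t (1, 0) ≤ M := by
  obtain ⟨M, hM⟩ := hH
  refine ⟨max M 1, by positivity, fun t ht => ?_⟩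
  have hle : ∫⁻ w, ENNReal.ofReal (Real.exp (σ' * (w.2 : ℝ))) ∂ W.P t (1, 0)
      ≤ ENNReal.ofReal (max M 1) := by
    refine (lintegral_mono fun w => ?_).trans ((hM t ht).trans
      (ENNReal.ofReal_le_ofReal (le_max_left _ _)))
    exact ENNReal.ofReal_le_ofReal (Real.exp_le_exp.2 (by nlinarith))
  have hmeas : AEStronglyMeasurable (fun w : ℕ × ℕ => Real.exp (σ' * (w.2 : ℝ)))
      (W.P t (1, 0)) := (measurable_of_countable _).aestronglyMeasurable
  have hnn : 0 ≤ᵐ[W.P t (1, 0)] fun w : ℕ × ℕ => Real.exp (σ' * (w.2 : ℝ)) :=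
    ae_of_all _ fun w => (Real.exp_pos _).le
  refine ⟨⟨hmeas, ?_⟩, ?_⟩
  · rw [hasFiniteIntegral_iff_ofReal hnn]
    exact hle.trans_lt ENNReal.ofReal_lt_top
  · rw [integral_eq_lintegral_of_nonneg_ae hnn hmeas]
    exact ENNReal.toReal_le_of_le_ofReal (by positivity) hle

/-- Finiteness of the exponential moment of the total progeny forces exponential moments of
the offspring law. -/
lemma summable_exp_of_hMomentFinite {p : ℕ → ℝ} {σ v : ℝ} (hp : OffspringLaw p σ v)
    {W : MarkovSemigroup (ℕ × ℕ)} (hW : IsGWBSemigroup p W) {σ' : ℝ} (hσ' : 0 < σ')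
    (hH : HMomentFinite W σ') {r : ℝ} (hr : r < σ') :
    Summable fun k : ℕ => p k * Real.exp (r * k) := by
  obtain ⟨M, hM0, hM⟩ := hH.exists_integral_le hσ'
  have := W.prob
  obtain ⟨C, hC0, hC⟩ := exists_sq_mul_exp_le_const hr
  set g : ℕ × ℕ → ℝ := Set.indicator {(1, 0)} 1 with hg
  have hgs : g.support.Finite := (Set.finite_singleton _).subset Set.support_indicator_subset
  have hg1 : ∫ w, g w ∂ W.P 0 (1, 0) = 1 := by
    rw [W.init, integral_dirac]; simp [hg]
  have hcont : ContinuousWithinAt (fun t => ∫ w, g w ∂ W.P t (1, 0)) (Set.Ici 0) 0 :=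
    (hW g (bounded_of_support_finite hgs) (1, 0) 0 le_rfl).continuousWithinAt
  obtain ⟨T, hT0, hT⟩ : ∃ T : ℝ, 0 < T ∧ ∀ t, 0 ≤ t → t ≤ T →
      1 / 2 ≤ ∫ w, g w ∂ W.P t (1, 0) := by
    have h1 : ∀ᶠ t in 𝓝[≥] (0 : ℝ), 1 / 2 < ∫ w, g w ∂ W.P t (1, 0) :=
      hcont.eventually (lt_mem_nhds (by simp only [hg1]; norm_num))
    obtain ⟨T, hT0, hT⟩ := (mem_nhdsGE_iff_exists_Icc_subset).1 h1
    exact ⟨T, hT0, fun t h0 h1 => (hT ⟨h0, h1⟩).le⟩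
  suffices hbd : ∀ n : ℕ, ∑ k ∈ Finset.Ico 1 n, p k * Real.exp (r * k)
      ≤ 2 * (C * M / T + C * M) by
    refine summable_of_sum_range_le (c := p 0 + 2 * (C * M / T + C * M))
      (fun k => mul_nonneg (hp.nonneg k) (Real.exp_pos _).le) fun n => ?_
    rcases Nat.eq_zero_or_pos n with rfl | hn
    · have := hp.nonneg 0
      simp only [Finset.range_zero, Finset.sum_empty]
      positivity
    · rw [Finset.range_eq_Ico, Finset.sum_eq_sum_Ico_succ_bot hn]
      simpa using hbd n
  intro n
  set A := ∑ k ∈ Finset.Ico 1 n, p k * Real.exp (r * k) with hA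
  have hA0 : 0 ≤ A := Finset.sum_nonneg fun k _ => mul_nonneg (hp.nonneg k) (Real.exp_pos _).le
  set f : ℕ × ℕ → ℝ := fun w => if w.1 = w.2 ∧ 1 ≤ w.2 ∧ w.2 < n then Real.exp (r * w.2) else 0
    with hf
  have hf0 : ∀ w, 0 ≤ f w := fun w => by simp only [hf]; split_ifs <;> positivity
  have hfs : ∀ w : ℕ × ℕ, f w ≠ 0 → w.1 ≤ w.2 + 1 ∧ w.2 < n := fun w hw => by
    simp only [hf, ne_eq, ite_eq_right_iff, not_forall] at hw
    obtain ⟨h, -⟩ := hw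
    omega
  have hfin := support_finite_of_le hfs
  have hb := bounded_of_support_finite hfin
  have hfC : ∀ w, (w.1 : ℝ) * f w ≤ C * Real.exp (σ' * w.2) ∧ f w ≤ C * Real.exp (σ' * w.2) := by
    intro w
    have h1 := hC w.2
    have h2 := Real.exp_pos (r * (w.2 : ℝ))
    have h3 := (w.2.cast_nonneg (α := ℝ))
    simp only [hf]
    split_ifs with h
    · rw [h.1]
      constructor <;> nlinarith [mul_nonneg h3 h2.le, mul_nonneg (mul_nonneg h3 h3) h2.le]
    · constructor <;> [rw [mul_zero]; skip] <;> positivity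
  have hgen : ∀ w, A * g w - C * Real.exp (σ' * w.2) ≤ gwbGen p f w := by
    intro w
    have h1 := le_gwbGen_of_nonneg hp hb hf0 w (Finset.Ico 1 n)
    have h2 := (hfC w).1
    refine le_trans ?_ h1
    by_cases hw : w = (1, 0)
    · subst hw
      have h3 : ∑ k ∈ Finset.Ico 1 n, p k * f (1 + k - 1, 0 + k) = A := by
        refine Finset.sum_congr rfl fun k hk => ?_
        have := Finset.mem_Ico.1 hk
        simp [hf, this]
      simp only [h3]
      simp only [hg, Set.indicator_of_mem (Set.mem_singleton _), Pi.one_apply] at h2 ⊢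
      simp only [Nat.cast_one, one_mul, mul_one] at h2 ⊢
      linarith
    · have h3 : g w = 0 := by simp [hg, hw]
      have h4 : 0 ≤ (w.1 : ℝ) * ∑ k ∈ Finset.Ico 1 n, p k * f (w.1 + k - 1, w.2 + k) :=
        mul_nonneg w.1.cast_nonneg (Finset.sum_nonneg fun k _ =>
          mul_nonneg (hp.nonneg k) (hf0 _))
      rw [h3]
      linarith
  have hgrow := add_mul_le_of_le_deriv (c := A / 2 - C * M) hT0.le
    (fun t ht => hW f hb (1, 0) t ht) (fun t ht htT => by
      obtain ⟨hi, hiM⟩ := hM t ht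
      have h1 : ∫ w, (A * g w - C * Real.exp (σ' * w.2)) ∂ W.P t (1, 0)
          ≤ ∫ w, gwbGen p f w ∂ W.P t (1, 0) :=
        integral_mono (((integrable_of_support_finite hgs).const_mul _).sub (hi.const_mul _))
          (integrable_of_support_finite (support_gwbGen_finite hfs)) hgen
      rw [integral_sub ((integrable_of_support_finite hgs).const_mul _) (hi.const_mul _),
        integral_const_mul, integral_const_mul] at h1
      have h2 := hT t ht htT
      have h3 := mul_le_mul_of_nonneg_left h2 hA0
      have h4 := mul_le_mul_of_nonneg_left hiM hC0
      linarith)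
  have hstart : 0 ≤ ∫ w, f w ∂ W.P 0 (1, 0) := integral_nonneg hf0
  have hend : ∫ w, f w ∂ W.P T (1, 0) ≤ C * M := by
    obtain ⟨hi, hiM⟩ := hM T hT0.le
    calc ∫ w, f w ∂ W.P T (1, 0) ≤ ∫ w, C * Real.exp (σ' * w.2) ∂ W.P T (1, 0) :=
          integral_mono (integrable_of_support_finite hfin) (hi.const_mul _) fun w => (hfC w).2
      _ ≤ C * M := by
          rw [integral_const_mul]
          exact mul_le_mul_of_nonneg_left hiM hC0
  have h1 : (A / 2 - C * M) * T ≤ C * M := by linarith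
  have h2 : A / 2 - C * M ≤ C * M / T := by rwa [le_div_iff₀ hT0]
  linarith

/-- Polynomial weights do not affect the finiteness of exponential moments. -/
lemma summable_mul_exp {p : ℕ → ℝ} {σ v : ℝ} (hp : OffspringLaw p σ v) {ρ r : ℝ} (hρr : ρ < r)
    (h : Summable fun k : ℕ => p k * Real.exp (r * k)) :
    Summable fun k : ℕ => p k * (k * Real.exp (ρ * k)) := by
  obtain ⟨C, -, hC⟩ := exists_sq_mul_exp_le_const hρr
  refine Summable.of_nonneg_of_le (fun k => mul_nonneg (hp.nonneg k) (by positivity))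
    (fun k => ?_) (h.mul_left C)
  have h1 := hC k
  have h2 := Real.exp_pos (ρ * (k : ℝ))
  have h3 := k.cast_nonneg (α := ℝ)
  have h4 : k * Real.exp (ρ * k) ≤ C * Real.exp (r * k) := by
    nlinarith [mul_nonneg h3 h2.le, mul_nonneg (mul_nonneg h3 h3) h2.le]
  have h5 := mul_le_mul_of_nonneg_left h4 (hp.nonneg k)
  linarith

/-- The exponentially tilted offspring law is still not supercritical:
`∑ k p(k) e^{ρ k} ≤ 1` for `ρ < σ'`. -/
lemma tsum_mul_exp_le_one {p : ℕ → ℝ} {σ v : ℝ} (hp : OffspringLaw p σ v)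
    {W : MarkovSemigroup (ℕ × ℕ)} (hW : IsGWBSemigroup p W) {σ' : ℝ} (hσ' : 0 < σ')
    (hH : HMomentFinite W σ') {ρ : ℝ} (hρ0 : 0 < ρ) (hρ : ρ < σ') :
    ∑' k : ℕ, p k * (k * Real.exp (ρ * k)) ≤ 1 := by
  obtain ⟨M, hM0, hM⟩ := hH.exists_integral_le hσ'
  have := W.prob
  obtain ⟨r, hρr, hrσ⟩ := exists_between hρ
  have hsr := summable_exp_of_hMomentFinite hp hW hσ' hH hrσ
  have hsρ := summable_mul_exp hp hρr hsr
  set Φ := ∑' k : ℕ, p k * Real.exp (r * k) with hΦ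
  have hΦ0 : 0 ≤ Φ := tsum_nonneg fun k => mul_nonneg (hp.nonneg k) (Real.exp_pos _).le
  by_contra! hgt
  set δ := ∑' k : ℕ, p k * (k * Real.exp (ρ * k)) - 1 with hδ
  have hδ0 : 0 < δ := by linarith
  obtain ⟨ε, hε0, hε⟩ : ∃ ε : ℝ, 0 < ε ∧ ε * Φ * M < δ := by
    refine ⟨δ / (Φ * M + 1), by positivity, ?_⟩
    rw [mul_assoc, div_mul_eq_mul_div, div_lt_iff₀ (by positivity)]
    nlinarith
  obtain ⟨n, hn⟩ := exists_sq_mul_exp_le hρr hε0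
  set f : ℕ × ℕ → ℝ := fun w =>
    if w.1 ≤ w.2 + 1 ∧ w.2 < n + 1 then w.1 * Real.exp (ρ * w.2) else 0 with hf
  have hf0 : ∀ w, 0 ≤ f w := fun w => by simp only [hf]; split_ifs <;> positivity
  have hfs : ∀ w : ℕ × ℕ, f w ≠ 0 → w.1 ≤ w.2 + 1 ∧ w.2 < n + 1 := fun w hw => by
    simp only [hf, ne_eq, ite_eq_right_iff, not_forall] at hw
    exact hw.1
  have hfin := support_finite_of_le hfs
  have hb := bounded_of_support_finite hfin
  have hgen : ∀ w, δ * f w - ε * Φ * Real.exp (σ' * w.2) ≤ gwbGen p f w := by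
    intro w
    have herr : 0 ≤ ε * Φ * Real.exp (σ' * w.2) := by positivity
    by_cases hw : w.1 ≤ w.2 + 1 ∧ w.2 < n + 1 ∧ 1 ≤ w.1
    swap
    · have h1 := le_gwbGen_of_nonneg hp hb hf0 w ∅
      have h2 : f w = 0 := by
        simp only [hf]
        split_ifs with h
        · have : w.1 = 0 := by omega
          simp [this]
        · rfl
      rw [h2] at h1 ⊢
      simp only [Finset.sum_empty] at h1
      linarith
    obtain ⟨z, b⟩ := w
    simp only at hw herr ⊢
    obtain ⟨hzb, hbn, hz⟩ := hw
    have hfw : f (z, b) = z * Real.exp (ρ * b) := if_pos ⟨hzb, hbn⟩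
    have hz' : (1 : ℝ) ≤ z := by exact_mod_cast hz
    have hzb' : (z : ℝ) ≤ b + 1 := by exact_mod_cast hzb
    have hterm : ∀ k : ℕ,
        (z * Real.exp (ρ * b)) * (p k * (k * Real.exp (ρ * k)) - p k)
          - ε * Real.exp (r * b) * (p k * Real.exp (r * k))
        ≤ (z : ℝ) * p k * (f (z + k - 1, b + k) - f (z, b)) := by
      intro k
      have hk : (0 : ℝ) ≤ k := k.cast_nonneg
      have hpk := hp.nonneg k
      have eρ : Real.exp (ρ * ((b + k : ℕ) : ℝ)) = Real.exp (ρ * b) * Real.exp (ρ * k) := by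
        rw [← Real.exp_add]; push_cast; ring_nf
      have er : Real.exp (r * ((b + k : ℕ) : ℝ)) = Real.exp (r * b) * Real.exp (r * k) := by
        rw [← Real.exp_add]; push_cast; ring_nf
      have hcast : ((z + k - 1 : ℕ) : ℝ) = z + k - 1 := by
        rw [Nat.cast_sub (by omega)]; push_cast; ring
      have h1k : 1 ≤ Real.exp (ρ * k) := Real.one_le_exp (by positivity)
      have hpb := Real.exp_pos (ρ * (b : ℝ))
      have hstep : z * ((z + k - 1) * (Real.exp (ρ * b) * Real.exp (ρ * k)))
          - ε * (Real.exp (r * b) * Real.exp (r * k)) ≤ z * f (z + k - 1, b + k) := by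
        by_cases hbk : b + k < n + 1
        · have : f (z + k - 1, b + k) = (z + k - 1) * (Real.exp (ρ * b) * Real.exp (ρ * k)) := by
            simp only [hf]
            rw [if_pos ⟨by omega, hbk⟩, eρ, hcast]
          rw [this]
          have : 0 ≤ ε * (Real.exp (r * b) * Real.exp (r * k)) := by positivity
          linarith
        · have h1 := hn (b + k) (by omega)
          rw [eρ, er] at h1
          have h2 : (z : ℝ) * (z + k - 1) ≤ (((b + k : ℕ) : ℝ) + 1) ^ 2 := by
            push_cast
            rw [sq]
            exact mul_le_mul (by linarith) (by linarith) (by linarith) (by positivity)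
          have h3 := mul_le_mul_of_nonneg_right h2
            (mul_pos hpb (Real.exp_pos (ρ * (k : ℝ)))).le
          have h4 := mul_nonneg (zero_le_one.trans hz') (hf0 (z + k - 1, b + k))
          linarith
      have hkey : (z * Real.exp (ρ * b)) * (k * Real.exp (ρ * k) - 1)
          ≤ z * ((z + k - 1) * (Real.exp (ρ * b) * Real.exp (ρ * k)))
            - z * (z * Real.exp (ρ * b)) := by
        have h1 : 0 ≤ (z * Real.exp (ρ * b)) * ((z - 1) * (Real.exp (ρ * k) - 1)) := by
          apply mul_nonneg (by positivity)
          exact mul_nonneg (by linarith) (by linarith)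
        linarith
      rw [hfw]
      have h5 := mul_le_mul_of_nonneg_left (add_le_add hstep hkey) hpk
      linarith
    have hs1 : Summable fun k : ℕ =>
        (z * Real.exp (ρ * b)) * (p k * (k * Real.exp (ρ * k)) - p k) :=
      (hsρ.sub hp.summable).mul_left _
    have hs2 : Summable fun k : ℕ => ε * Real.exp (r * b) * (p k * Real.exp (r * k)) :=
      hsr.mul_left _
    have h1 := (hs1.sub hs2).tsum_le_tsum hterm (summable_gwbGen hp hb (z, b))
    rw [hs1.tsum_sub hs2, tsum_mul_left, tsum_mul_left, hsρ.tsum_sub hp.summable, hp.total,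
      ← hδ, ← hΦ] at h1
    have h2 : Real.exp (r * b) ≤ Real.exp (σ' * b) :=
      Real.exp_le_exp.2 (mul_le_mul_of_nonneg_right hrσ.le b.cast_nonneg)
    have h3 := mul_le_mul_of_nonneg_left h2 (mul_nonneg hε0.le hΦ0)
    rw [hfw]
    unfold gwbGen
    simp only at h1 ⊢
    linarith
  obtain ⟨B, hB⟩ := hb
  have hfinal := mul_le_of_bounded_of_le_deriv (ε := ε * Φ * M) (B := B) hδ0
    (fun t ht => hW f ⟨B, hB⟩ (1, 0) t ht) (fun t ht => by
      obtain ⟨hi, hiM⟩ := hM t ht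
      have hfi : Integrable f (W.P t (1, 0)) := integrable_of_support_finite hfin
      have h1 : ∫ w, (δ * f w - ε * Φ * Real.exp (σ' * w.2)) ∂ W.P t (1, 0)
          ≤ ∫ w, gwbGen p f w ∂ W.P t (1, 0) :=
        integral_mono ((hfi.const_mul _).sub (hi.const_mul _))
          (integrable_of_support_finite (support_gwbGen_finite hfs)) hgen
      rw [integral_sub (hfi.const_mul _) (hi.const_mul _), integral_const_mul,
        integral_const_mul] at h1
      have h2 := mul_le_mul_of_nonneg_left hiM (mul_nonneg hε0.le hΦ0)
      linarith)
    (fun t _ => by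
      have h1 := integral_mono (integrable_of_support_finite (μ := W.P t (1, 0)) hfin)
        (integrable_const B) fun w => (le_abs_self _).trans (hB w)
      simpa using h1)
  have hinit : ∫ w, f w ∂ W.P 0 (1, 0) = 1 := by
    rw [W.init, integral_dirac]; simp [hf]
  simp only [hinit] at hfinal
  linarith

/-- The log-Laplace type bound `E[e^{ρ (k - 1)}] - 1 ≤ -v ρ / 4`. -/
lemma tsum_exp_jump_le {p : ℕ → ℝ} {σ v : ℝ} (hp : OffspringLaw p σ v) {ρ : ℝ} (hρ0 : 0 < ρ)
    (hρ1 : ρ ≤ 1) (hs : Summable fun k : ℕ => p k * (k * Real.exp (ρ * k)))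
    (h1 : ∑' k : ℕ, p k * (k * Real.exp (ρ * k)) ≤ 1)
    (hs' : Summable fun k : ℕ => p k * (Real.exp (ρ * ((k : ℝ) - 1)) - 1)) :
    ∑' k : ℕ, p k * (Real.exp (ρ * ((k : ℝ) - 1)) - 1) ≤ -(v * ρ / 4) := by
  have sa := hp.summable_drift.mul_left ((1 / 2 - ρ / 4) * ρ)
  have sb := (hs.sub hp.summable).mul_left (Real.exp (-ρ) / 2 * ρ)
  have h := hs'.tsum_le_tsum (fun k => by
    have := mul_le_mul_of_nonneg_left (exp_jump_le hρ0 hρ1 k) (hp.nonneg k)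
    exact this.trans (le_of_eq (by ring))) (sa.add sb)
  rw [sa.tsum_add sb, tsum_mul_left, tsum_mul_left, hs.tsum_sub hp.summable, hp.total,
    hp.drift] at h
  have h2 : Real.exp (-ρ) / 2 * ρ * (∑' k : ℕ, p k * (k * Real.exp (ρ * k)) - 1) ≤ 0 :=
    mul_nonpos_of_nonneg_of_nonpos (by positivity) (by linarith)
  have h3 : 0 ≤ (1 - ρ) * (ρ * v) := mul_nonneg (by linarith) (mul_pos hρ0 hp.v_pos).le
  nlinarith

/-- **Exponential drift bound for the reflected Galton-Watson generator.**
With `Γ(ρ) = p(0) + ∑_{ℓ≥1} p(ℓ+1) ℓ² e^{ρℓ}` and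
`β = sup{ρ > 0 : ρΓ(ρ) ≤ v}`, for every `0 < ρ < min{β, σ'}` and `x ≥ 1`,
`Q̃(e^{ρ·})(x) ≤ -(vρ/2) e^{ρx} + e^ρ`. -/
theorem gw_reflected_exp_drift
    (p : ℕ → ℝ) (σ v : ℝ) (hp : OffspringLaw p σ v)
    (W : MarkovSemigroup (ℕ × ℕ)) (hW : IsGWBSemigroup p W)
    (σ' : ℝ) (hσ' : 0 < σ') (hH : HMomentFinite W σ')
    (ρ : ℝ) (hρ0 : 0 < ρ) (hρ : ρ < min (gwBeta p v) σ')
    (x : ℕ) (hx : 1 ≤ x) :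
    gwQRefl p (fun y => Real.exp (ρ * (y : ℝ))) x ≤
      -(v * ρ / 2) * Real.exp (ρ * (x : ℝ)) + Real.exp ρ := by
  have hv := hp.v_pos
  have hv0 := hp.v_le
  have hp1 := hp.p_zero_le_one
  have hρ1 := lt_one_of_lt_gwBeta hp (hρ.trans_le (min_le_left _ _))
  have hρσ := hρ.trans_le (min_le_right _ _)
  obtain ⟨r, hρr, hrσ⟩ := exists_between hρσ
  have hsr := summable_exp_of_hMomentFinite hp hW hσ' hH hrσ
  have hs := summable_mul_exp hp hρr hsr
  have hs' : Summable fun k : ℕ => p k * (Real.exp (ρ * ((k : ℝ) - 1)) - 1) := by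
    have h1 := summable_exp_of_hMomentFinite hp hW hσ' hH hρσ
    refine ((h1.mul_left (Real.exp (-ρ))).sub hp.summable).congr fun k => ?_
    have e : Real.exp (ρ * ((k : ℝ) - 1)) = Real.exp (-ρ) * Real.exp (ρ * k) := by
      rw [← Real.exp_add]; ring_nf
    rw [e]; ring
  have hM := tsum_exp_jump_le hp hρ0 hρ1.le hs (tsum_mul_exp_le_one hp hW hσ' hH hρ0 hρσ) hs'
  have hterm : ∀ k : ℕ, 1 ≤ x + k - 1 →
      Real.exp (ρ * ((x + k - 1 : ℕ) : ℝ)) - Real.exp (ρ * x)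
        = Real.exp (ρ * x) * (Real.exp (ρ * ((k : ℝ) - 1)) - 1) := by
    intro k hk
    have e : Real.exp (ρ * ((x + k - 1 : ℕ) : ℝ))
        = Real.exp (ρ * x) * Real.exp (ρ * ((k : ℝ) - 1)) := by
      rw [← Real.exp_add, Nat.cast_sub (by omega)]; push_cast; ring_nf
    rw [e]; ring
  unfold gwQRefl
  rcases Nat.lt_or_ge 1 x with hx2 | hx1
  · have e : ∀ k : ℕ, (x : ℝ) * p k * (if 1 ≤ x + k - 1 then
        Real.exp (ρ * ((x + k - 1 : ℕ) : ℝ)) - Real.exp (ρ * x) else 0)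
        = x * Real.exp (ρ * x) * (p k * (Real.exp (ρ * ((k : ℝ) - 1)) - 1)) := by
      intro k
      have hk : 1 ≤ x + k - 1 := by omega
      rw [if_pos hk, hterm k hk]; ring
    rw [tsum_congr e, tsum_mul_left]
    have hx' : (2 : ℝ) ≤ x := by exact_mod_cast hx2
    have h1 := mul_le_mul_of_nonneg_left hM
      (mul_nonneg (x.cast_nonneg (α := ℝ)) (Real.exp_pos (ρ * x)).le)
    have h2 : 0 ≤ (x - 2) * (Real.exp (ρ * x) * (v * ρ / 4)) :=
      mul_nonneg (by linarith) (by positivity)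
    have h3 := Real.exp_pos ρ
    linarith
  · obtain rfl : x = 1 := le_antisymm hx1 hx
    have e : ∀ k : ℕ, ((1 : ℕ) : ℝ) * p k * (if 1 ≤ 1 + k - 1 then
        Real.exp (ρ * ((1 + k - 1 : ℕ) : ℝ)) - Real.exp (ρ * (1 : ℕ)) else 0)
        = Real.exp ρ * (p k * (Real.exp (ρ * ((k : ℝ) - 1)) - 1))
          + if k = 0 then p 0 * (Real.exp ρ - 1) else 0 := by
      intro k
      rcases k with _ | k
      · have hE : Real.exp ρ * Real.exp (-ρ) = 1 := by rw [← Real.exp_add]; simp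
        simp only [Nat.cast_zero, zero_sub, mul_neg, mul_one]
        simp
        linear_combination (-p 0) * hE
      · have hk : 1 ≤ 1 + (k + 1) - 1 := by omega
        rw [if_pos hk, hterm _ hk]
        simp
        ring
    have hs0 : Summable fun k : ℕ => if k = 0 then p 0 * (Real.exp ρ - 1) else 0 :=
      (hasSum_ite_eq 0 _).summable
    rw [tsum_congr e, (hs'.mul_left _).tsum_add hs0, tsum_mul_left, tsum_ite_eq]
    have h1 := mul_le_mul_of_nonneg_left hM (Real.exp_pos ρ).le
    have h2 : Real.exp ρ < 3 := (Real.exp_lt_exp.2 hρ1).trans Real.exp_one_lt_three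
    have h3 : 1 ≤ Real.exp ρ := Real.one_le_exp hρ0.le
    have h4 : p 0 * (Real.exp ρ - 1) ≤ 1 * (Real.exp ρ - 1) :=
      mul_le_mul_of_nonneg_right hp1 (by linarith)
    have h5 : v * ρ ≤ 1 := mul_le_one₀ (by linarith) hρ0.le hρ1.le
    have h6 := mul_le_mul_of_nonneg_left h5 (Real.exp_pos ρ).le
    simp only [Nat.cast_one, mul_one]
    linarith

end
end

section
/- Let Γ(ρ) := p(0) + ∑_{ℓ≥1} p(ℓ+1) ℓ² e^{ρℓ} and β := sup{ρ > 0 : ρΓ(ρ) ≤ v}. Then for every 0 < ρ < min{β, σ'}, every x ∈ ℕ and every t ≥ 0, the reflected Galton-Watson process satisfies E[exp(ρ Z̃^x_t)] ≤ e^{−ρvt/2} e^{ρx} + t e^{ρ}. -/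
open MeasureTheory Filter Topology Set

noncomputable section

/-- A function whose right derivative is at most `K - c g` on `[0, T]`. -/
lemma le_of_deriv_right_le_affine {g g' : ℝ → ℝ} {c K T : ℝ} (hc : 0 ≤ c) (hK : 0 ≤ K)
    (hT : 0 ≤ T) (hg : ∀ t, 0 ≤ t → HasDerivWithinAt g (g' t) (Ici 0) t)
    (hle : ∀ t, 0 ≤ t → t ≤ T → g' t ≤ -c * g t + K) :
    g T ≤ Real.exp (-c * T) * g 0 + T * K := by
  have hd : ∀ t, 0 ≤ t → HasDerivWithinAt (fun s => Real.exp (c * s) * g s)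
      (Real.exp (c * t) * c * g t + Real.exp (c * t) * g' t) (Ici 0) t := fun t ht =>
    ((((hasDerivAt_id t).const_mul c).exp.congr_deriv (by simp)).hasDerivWithinAt).mul (hg t ht)
  have key := image_le_of_deriv_right_le_deriv_boundary
    (f := fun s => Real.exp (c * s) * g s) (B := fun s => g 0 + s * (Real.exp (c * T) * K))
    (B' := fun _ => Real.exp (c * T) * K) (a := 0) (b := T)
    (fun t ht => (hd t ht.1).continuousWithinAt.mono Icc_subset_Ici_self)
    (fun t ht => (hd t ht.1).mono (Ici_subset_Ici.2 ht.1)) (by simp) (by fun_prop)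
    (fun t _ => ((hasDerivAt_id t).mul_const _ |>.const_add _ |>.congr_deriv
      (by simp)).hasDerivWithinAt)
    (fun t ht => by
      have h1 := hle t ht.1 ht.2.le
      have h2 : Real.exp (c * t) ≤ Real.exp (c * T) :=
        Real.exp_le_exp.2 (mul_le_mul_of_nonneg_left ht.2.le hc)
      calc _ = Real.exp (c * t) * (c * g t + g' t) := by ring
        _ ≤ Real.exp (c * t) * K := by gcongr; linarith
        _ ≤ _ := by gcongr) (right_mem_Icc.2 hT)
  have h3 : Real.exp (-c * T) * Real.exp (c * T) = 1 := by
    rw [← Real.exp_add]; simp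
  calc g T = Real.exp (-c * T) * (Real.exp (c * T) * g T) := by rw [← mul_assoc, h3, one_mul]
    _ ≤ Real.exp (-c * T) * (g 0 + T * (Real.exp (c * T) * K)) := by gcongr
    _ = Real.exp (-c * T) * g 0 + T * K * (Real.exp (-c * T) * Real.exp (c * T)) := by ring
    _ = _ := by rw [h3, mul_one]

/-- The trapezoidal rule overestimates the integral of the exponential. -/
lemma two_mul_exp_sub_one_le {x : ℝ} (hx : 0 ≤ x) :
    2 * (Real.exp x - 1) ≤ x * (Real.exp x + 1) := by
  have h : MonotoneOn (fun y : ℝ => y * (Real.exp y + 1) - 2 * (Real.exp y - 1)) (Ici 0) := by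
    refine monotoneOn_of_deriv_nonneg (convex_Ici 0) (by fun_prop) (by fun_prop) fun y hy => ?_
    have hd : HasDerivAt (fun y : ℝ => y * (Real.exp y + 1) - 2 * (Real.exp y - 1))
        (1 * (Real.exp y + 1) + y * Real.exp y - 2 * Real.exp y) y :=
      ((hasDerivAt_id y).mul ((Real.hasDerivAt_exp y).add_const 1)).sub
        (((Real.hasDerivAt_exp y).sub_const 1).const_mul 2)
    rw [hd.deriv]
    have h1 := Real.add_one_le_exp (-y)
    have h2 : Real.exp (-y) * Real.exp y = 1 := by rw [← Real.exp_add]; simp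
    nlinarith [Real.exp_pos y]
  have := h (mem_Ici.2 le_rfl) (mem_Ici.2 hx) hx
  simp at this
  linarith

lemma exp_le_one_add_add_sq {x : ℝ} (hx : 0 ≤ x) :
    Real.exp x ≤ 1 + x + x ^ 2 / 2 * Real.exp x := by
  have h := two_mul_exp_sub_one_le hx
  have h1 := Real.add_one_le_exp (-x)
  have h2 : Real.exp (-x) * Real.exp x = 1 := by rw [← Real.exp_add]; simp
  have h3 : Real.exp x - 1 ≤ x * Real.exp x := by nlinarith [Real.exp_pos x]
  nlinarith

lemma exp_neg_le_one_sub_add_sq {x : ℝ} (hx : 0 ≤ x) :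
    Real.exp (-x) ≤ 1 - x + x ^ 2 / 2 := by
  have h1 := Real.quadratic_le_exp_of_nonneg hx
  have h2 : Real.exp (-x) * Real.exp x = 1 := by rw [← Real.exp_add]; simp
  have h3 : 0 < 1 - x + x ^ 2 / 2 := by nlinarith [sq_nonneg (x - 1)]
  have h4 : 1 ≤ (1 - x + x ^ 2 / 2) * Real.exp x := by
    calc (1 : ℝ) ≤ (1 - x + x ^ 2 / 2) * (1 + x + x ^ 2 / 2) := by nlinarith [sq_nonneg (x ^ 2)]
      _ ≤ _ := by gcongr
  nlinarith [Real.exp_pos x]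

/-- A chord-slope inequality for the exponential. -/
lemma exp_trapezoid_chord {a b : ℝ} (ha : 0 ≤ a) (hab : a ≤ b) :
    (2 * b - a) * (Real.exp a - 1) ≤ a * (Real.exp b - 1) + (b - a) * a := by
  have h1 := two_mul_exp_sub_one_le ha
  have h2 := Real.add_one_le_exp (b - a)
  have h3 : Real.exp (b - a) * Real.exp a = Real.exp b := by rw [← Real.exp_add]; simp
  have h4 : (b - a + 1) * Real.exp a ≤ Real.exp b := by rw [← h3]; gcongr
  nlinarith [mul_le_mul_of_nonneg_left h4 ha, mul_le_mul_of_nonneg_left h1 (sub_nonneg.2 hab)]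

/-- The elementary inequality controlling the contribution of deaths when `θ ≤ 1`. -/
lemma death_term_inequality {r θ : ℝ} (hr : 0 ≤ r) (hrθ : r ≤ θ) (hθ : θ ≤ 1) :
    θ * r + r * (1 - Real.exp (-θ)) ≤ 2 * θ * (1 - Real.exp (-r)) + r ^ 2 / 2 := by
  have hθ0 := hr.trans hrθ
  have hb := fun (x : ℝ) (h0 : 0 ≤ x) (h1 : x ≤ 1) =>
    Real.exp_bound (x := -x) (by rw [abs_neg, abs_of_nonneg h0]; exact h1) (n := 6) (by norm_num)
  have h1 := abs_le.1 (hb r hr (hrθ.trans hθ))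
  have h2 := abs_le.1 (hb θ hθ0 hθ)
  simp only [abs_neg, abs_of_nonneg hr, abs_of_nonneg hθ0, Finset.sum_range_succ,
    Finset.sum_range_zero, Nat.factorial] at h1 h2
  norm_num at h1 h2
  have er : Real.exp (-r) ≤ 1 - r + r ^ 2 / 2 - r ^ 3 / 6 + r ^ 4 / 24 := by
    have : r ^ 6 ≤ r ^ 5 := pow_le_pow_of_le_one hr (hrθ.trans hθ) (by norm_num)
    have : 0 ≤ r ^ 5 := by positivity
    nlinarith [h1.2]
  have eθ : 1 - θ + θ ^ 2 / 2 - θ ^ 3 / 6 ≤ Real.exp (-θ) := by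
    have : θ ^ 6 ≤ θ ^ 4 := pow_le_pow_of_le_one hθ0 hθ (by norm_num)
    have : θ ^ 5 ≤ θ ^ 4 := pow_le_pow_of_le_one hθ0 hθ (by norm_num)
    have : 0 ≤ θ ^ 4 := by positivity
    nlinarith [h2.1]
  have hP : 0 ≤ θ ^ 2 / 2 - θ ^ 3 / 6 - (θ - 1 / 2) * r + θ * r ^ 2 / 4 := by
    have hdisc : (θ - 1 / 2) ^ 2 ≤ θ * (θ ^ 2 / 2 - θ ^ 3 / 6) ∨ θ ≤ 1 / 2 := by
      by_cases h : θ ≤ 1 / 2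
      · exact Or.inr h
      · left
        push Not at h
        nlinarith [mul_nonneg hθ0 (sub_nonneg.2 hθ),
          mul_nonneg (sub_nonneg.2 h.le) (sub_nonneg.2 hθ),
          mul_nonneg (mul_nonneg (sub_nonneg.2 h.le) (sub_nonneg.2 hθ)) hθ0, pow_nonneg hθ0 3]
    rcases hdisc with h | h
    · rcases hθ0.eq_or_lt with h0 | h0
      · subst h0; nlinarith
      · have : 0 ≤ θ * (θ ^ 2 / 2 - θ ^ 3 / 6 - (θ - 1 / 2) * r + θ * r ^ 2 / 4) := by
          nlinarith [sq_nonneg (θ * r / 2 - (θ - 1 / 2))]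
        exact nonneg_of_mul_nonneg_right this h0
    · have : 0 ≤ θ ^ 2 * (3 - θ) := by nlinarith [sq_nonneg θ]
      have : 0 ≤ θ * r ^ 2 := by positivity
      nlinarith
  have h5 : 0 ≤ θ * r ^ 3 * (1 - r) := mul_nonneg (by positivity) (by linarith)
  nlinarith [mul_nonneg hr hP, mul_le_mul_of_nonneg_left er hθ0, mul_le_mul_of_nonneg_left eθ hr]

/-- `φ(ρ) = ∑_{ℓ ≥ -1} p(ℓ+1) (1 - e^{ρℓ})`, so that `Q e^{ρ·}(x) = -x φ(ρ) e^{ρx}`. -/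
def gwPhi (p : ℕ → ℝ) (ρ : ℝ) : ℝ :=
  ∑' k : ℕ, p k * (1 - Real.exp (ρ * ((k : ℝ) - 1)))

section OffspringLaw

variable {p : ℕ → ℝ} {σ v : ℝ}

lemma OffspringLaw.summable_s12 (hp : OffspringLaw p σ v) : Summable p := by
  by_contra h
  have := hp.total
  rw [tsum_eq_zero_of_not_summable h] at this
  norm_num at this

lemma OffspringLaw.hasSum_drift (hp : OffspringLaw p σ v) :
    HasSum (fun k : ℕ => p k * ((k : ℝ) - 1)) (-v) := by
  have h : Summable fun k : ℕ => ((k : ℝ) - 1) * p k := by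
    by_contra h
    have h1 := hp.drift
    rw [tsum_eq_zero_of_not_summable h] at h1
    linarith [hp.v_pos]
  have h2 := h.hasSum
  rw [hp.drift] at h2
  simpa only [mul_comm] using h2

lemma OffspringLaw.v_le_s12 (hp : OffspringLaw p σ v) : v ≤ p 0 := by
  have h1 : HasSum (fun k : ℕ => if k = 0 then -p 0 else 0) (-p 0) := hasSum_ite_eq 0 (-p 0)
  have := hasSum_le (fun k => ?_) h1 hp.hasSum_drift
  · linarith
  · split_ifs with h
    · subst h; simp
    · have : (1 : ℝ) ≤ k := by exact_mod_cast Nat.one_le_iff_ne_zero.2 h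
      exact mul_nonneg (hp.nonneg k) (by linarith)

lemma OffspringLaw.le_one (hp : OffspringLaw p σ v) (k : ℕ) : p k ≤ 1 :=
  hp.total ▸ hp.summable_s12.le_tsum k fun j _ => hp.nonneg j

lemma summable_mul_exp_sub_one {a : ℝ} (h : Summable fun k : ℕ => p k * Real.exp (a * k)) :
    Summable fun k : ℕ => p k * Real.exp (a * ((k : ℝ) - 1)) := by
  refine (h.mul_right (Real.exp (-a))).congr fun k => ?_
  rw [mul_assoc, ← Real.exp_add]
  ring_nf

lemma summable_exp_of_le (hp : OffspringLaw p σ v) {a b : ℝ} (hab : a ≤ b)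
    (h : Summable fun k : ℕ => p k * Real.exp (b * k)) :
    Summable fun k : ℕ => p k * Real.exp (a * k) :=
  h.of_nonneg_of_le (fun k => mul_nonneg (hp.nonneg k) (Real.exp_pos _).le) fun k =>
    mul_le_mul_of_nonneg_left (Real.exp_le_exp.2 (by gcongr)) (hp.nonneg k)

lemma OffspringLaw.hasSum_phi (hp : OffspringLaw p σ v) {a : ℝ}
    (h : Summable fun k : ℕ => p k * Real.exp (a * k)) :
    HasSum (fun k : ℕ => p k * (1 - Real.exp (a * ((k : ℝ) - 1)))) (gwPhi p a) :=
  ((hp.summable_s12.sub (summable_mul_exp_sub_one h)).congr fun k => by ring).hasSum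

lemma OffspringLaw.phi_le_one (hp : OffspringLaw p σ v) {a : ℝ}
    (h : Summable fun k : ℕ => p k * Real.exp (a * k)) : gwPhi p a ≤ 1 := by
  have h1 := hp.summable_s12.hasSum
  rw [hp.total] at h1
  refine hasSum_le (fun k => ?_) (hp.hasSum_phi h) h1
  nlinarith [mul_nonneg (hp.nonneg k) (Real.exp_pos (a * ((k : ℝ) - 1))).le]

lemma OffspringLaw.phi_le (hp : OffspringLaw p σ v) {a : ℝ}
    (h : Summable fun k : ℕ => p k * Real.exp (a * k)) : gwPhi p a ≤ a * v := by
  have h1 := hp.hasSum_drift.mul_left (-a)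
  rw [neg_mul_neg] at h1
  refine hasSum_le (fun k => ?_) (hp.hasSum_phi h) h1
  have := Real.add_one_le_exp (a * ((k : ℝ) - 1))
  nlinarith [hp.nonneg k]

/-- The summand of `Γ`, without the offspring weights. -/
def gammaWeight (ρ : ℝ) (k : ℕ) : ℝ :=
  if k = 0 then 1 else ((k : ℝ) - 1) ^ 2 * Real.exp (ρ * ((k : ℝ) - 1))

lemma hasSum_gamma {ρ : ℝ}
    (h : Summable fun ℓ : ℕ => p (ℓ + 2) * ((ℓ : ℝ) + 1) ^ 2 * Real.exp (ρ * ((ℓ : ℝ) + 1))) :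
    HasSum (fun k : ℕ => p k * gammaWeight ρ k) (gwGamma p ρ) := by
  have h0 : gwGamma p ρ - ∑ i ∈ Finset.range 2, p i * gammaWeight ρ i
      = ∑' ℓ : ℕ, p (ℓ + 2) * ((ℓ : ℝ) + 1) ^ 2 * Real.exp (ρ * ((ℓ : ℝ) + 1)) := by
    simp [gwGamma, gammaWeight, Finset.sum_range_succ]
  rw [← hasSum_nat_add_iff' 2, h0]
  refine h.hasSum.congr_fun fun ℓ => ?_
  rw [gammaWeight, if_neg (by omega)]
  push_cast
  ring_nf

lemma OffspringLaw.half_le_phi_of_gamma (hp : OffspringLaw p σ v) {ρ : ℝ} (hρ : 0 ≤ ρ)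
    (hs : Summable fun k : ℕ => p k * Real.exp (ρ * k))
    (h : Summable fun ℓ : ℕ => p (ℓ + 2) * ((ℓ : ℝ) + 1) ^ 2 * Real.exp (ρ * ((ℓ : ℝ) + 1)))
    (hΓ : ρ * gwGamma p ρ ≤ v) : ρ * v / 2 ≤ gwPhi p ρ := by
  have h1 := (hp.hasSum_drift.mul_left (-ρ)).sub ((hasSum_gamma h).mul_left (ρ ^ 2 / 2))
  have h2 := hasSum_le (fun k => ?_) h1 (hp.hasSum_phi hs)
  · nlinarith
  · have : -ρ * ((k : ℝ) - 1) - ρ ^ 2 / 2 * gammaWeight ρ k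
        ≤ 1 - Real.exp (ρ * ((k : ℝ) - 1)) := by
      unfold gammaWeight
      split_ifs with hk
      · subst hk
        have := exp_neg_le_one_sub_add_sq hρ
        simp only [Nat.cast_zero, zero_sub, mul_neg, mul_one]
        linarith
      · have hk1 : (1 : ℝ) ≤ k := by exact_mod_cast Nat.one_le_iff_ne_zero.2 hk
        have := exp_le_one_add_add_sq (mul_nonneg hρ (sub_nonneg.2 hk1))
        linarith
    nlinarith [mul_le_mul_of_nonneg_left this (hp.nonneg k)]

lemma OffspringLaw.half_le_phi_of_le_one (hp : OffspringLaw p σ v) {ρ θ : ℝ} (hρ : 0 < ρ)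
    (hρθ : ρ < θ) (hθ : θ ≤ 1) (hs : Summable fun k : ℕ => p k * Real.exp (θ * k))
    (hφ : 1 - Real.exp (-ρ) ≤ gwPhi p θ) : ρ * v / 2 ≤ gwPhi p ρ := by
  set D : ℝ := ρ * (1 - Real.exp (-θ)) + (θ - ρ) * ρ
    - (2 * θ - ρ) * (1 - Real.exp (-ρ)) with hD
  have hdeath := death_term_inequality hρ.le hρθ.le hθ
  have hx : ρ / 2 ≤ 1 - Real.exp (-ρ) := by
    have := exp_neg_le_one_sub_add_sq hρ.le
    nlinarith
  have h1 := ((hp.hasSum_phi hs).mul_left ρ).sub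
    (hasSum_ite_eq (0 : ℕ) (D * p 0))
  have h2 := ((hp.hasSum_phi (summable_exp_of_le hp hρθ.le hs)).mul_left (2 * θ - ρ)).add
    (hp.hasSum_drift.mul_left ((θ - ρ) * ρ))
  have h3 := hasSum_le (fun k => ?_) h1 h2
  · have hp1 := hp.le_one 0
    have hv := hp.v_le_s12
    have hp0 := hp.nonneg 0
    have h4 : ρ * (1 - Real.exp (-ρ)) ≤ ρ * gwPhi p θ := by gcongr
    have h5 : 0 ≤ ρ * (1 - Real.exp (-ρ)) - D * p 0 - ρ ^ 2 / 2 * p 0 := by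
      have e1 : 0 ≤ ρ * (1 - Real.exp (-ρ)) - D - ρ ^ 2 / 2 := by rw [hD]; nlinarith
      have e2 : 0 ≤ ρ * (1 - Real.exp (-ρ)) := by nlinarith
      nlinarith [mul_nonneg hp0 e1, mul_nonneg (sub_nonneg.2 hp1) e2]
    have h6 : ρ ^ 2 / 2 * v ≤ ρ ^ 2 / 2 * p 0 := by gcongr
    have h7 : 0 < 2 * θ - ρ := by linarith
    have h8 : (2 * θ - ρ) * (ρ * v / 2) ≤ (2 * θ - ρ) * gwPhi p ρ := by nlinarith
    exact le_of_mul_le_mul_left h8 h7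
  · rcases Nat.eq_zero_or_pos k with hk | hk
    · subst hk
      simp only [if_true, Nat.cast_zero, zero_sub, mul_neg, mul_one, hD]
      nlinarith
    · rw [if_neg hk.ne']
      obtain ⟨j, rfl⟩ : ∃ j, k = j + 1 := ⟨k - 1, by omega⟩
      simp only [Nat.cast_add, Nat.cast_one, add_sub_cancel_right]
      rcases Nat.eq_zero_or_pos j with hj | hj
      · subst hj; simp
      · have hj' : (0 : ℝ) < j := by exact_mod_cast hj
        have := exp_trapezoid_chord (a := ρ * j) (b := θ * j) (by positivity) (by gcongr)
        have h9 : (2 * θ - ρ) * (Real.exp (ρ * j) - 1)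
            ≤ ρ * (Real.exp (θ * j) - 1) + (θ - ρ) * ρ * j := by
          refine le_of_mul_le_mul_left ?_ hj'
          nlinarith
        nlinarith [mul_le_mul_of_nonneg_left h9 (hp.nonneg (j + 1))]

/-- If an exponential moment of order `θ` exists, then `Γ` is finite below `θ`. -/
lemma summable_gamma_of_lt (hp : OffspringLaw p σ v) {ρ θ : ℝ} (hρθ : ρ < θ)
    (hs : Summable fun k : ℕ => p k * Real.exp (θ * k)) :
    Summable fun ℓ : ℕ => p (ℓ + 2) * ((ℓ : ℝ) + 1) ^ 2 * Real.exp (ρ * ((ℓ : ℝ) + 1)) := by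
  have h1 := ((summable_nat_add_iff 2).2 (summable_mul_exp_sub_one hs)).mul_left
    (2 / (θ - ρ) ^ 2)
  refine h1.of_nonneg_of_le (fun ℓ => mul_nonneg (mul_nonneg (hp.nonneg _) (by positivity))
    (Real.exp_pos _).le) fun ℓ => ?_
  have hd : 0 < θ - ρ := sub_pos.2 hρθ
  have h2 := Real.quadratic_le_exp_of_nonneg (x := (θ - ρ) * ((ℓ : ℝ) + 1)) (by positivity)
  have h3 : ((ℓ : ℝ) + 1) ^ 2 ≤ 2 / (θ - ρ) ^ 2 * Real.exp ((θ - ρ) * ((ℓ : ℝ) + 1)) := by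
    rw [div_mul_eq_mul_div, le_div_iff₀ (by positivity)]
    have : 0 ≤ (θ - ρ) * ((ℓ : ℝ) + 1) := by positivity
    nlinarith
  have h4 : Real.exp (θ * (((ℓ + 2 : ℕ) : ℝ) - 1))
      = Real.exp ((θ - ρ) * ((ℓ : ℝ) + 1)) * Real.exp (ρ * ((ℓ : ℝ) + 1)) := by
    rw [← Real.exp_add]; push_cast; ring_nf
  rw [h4]
  calc _ ≤ p (ℓ + 2) * (2 / (θ - ρ) ^ 2 * Real.exp ((θ - ρ) * ((ℓ : ℝ) + 1)))
        * Real.exp (ρ * ((ℓ : ℝ) + 1)) := by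
        gcongr
        exact hp.nonneg _
    _ = _ := by ring

lemma gamma_mono (hp : OffspringLaw p σ v) {a b : ℝ} (hab : a ≤ b)
    (h : Summable fun ℓ : ℕ => p (ℓ + 2) * ((ℓ : ℝ) + 1) ^ 2 * Real.exp (b * ((ℓ : ℝ) + 1))) :
    (Summable fun ℓ : ℕ => p (ℓ + 2) * ((ℓ : ℝ) + 1) ^ 2 * Real.exp (a * ((ℓ : ℝ) + 1))) ∧
      gwGamma p a ≤ gwGamma p b := by
  have hle : ∀ ℓ : ℕ, p (ℓ + 2) * ((ℓ : ℝ) + 1) ^ 2 * Real.exp (a * ((ℓ : ℝ) + 1))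
      ≤ p (ℓ + 2) * ((ℓ : ℝ) + 1) ^ 2 * Real.exp (b * ((ℓ : ℝ) + 1)) := fun ℓ =>
    mul_le_mul_of_nonneg_left (Real.exp_le_exp.2 (by gcongr))
      (mul_nonneg (hp.nonneg _) (by positivity))
  have hs := h.of_nonneg_of_le (fun ℓ => mul_nonneg (mul_nonneg (hp.nonneg _) (by positivity))
    (Real.exp_pos _).le) hle
  exact ⟨hs, add_le_add_right (hs.tsum_le_tsum hle h) _⟩

/-- Below `β`, and below an order `s` reachable as `θ - log E e^{θ ξ}`, the function
`φ` dominates half of its tangent at the origin. -/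
lemma OffspringLaw.half_le_phi (hp : OffspringLaw p σ v) {s θ ρ : ℝ}
    (hθ : Summable fun k : ℕ => p k * Real.exp (θ * k))
    (hθs : ∑' k : ℕ, p k * Real.exp (θ * k) ≤ Real.exp (θ - s))
    (hρ : 0 < ρ) (hρβ : ρ < gwBeta p v) (hρs : ρ < s) :
    (Summable fun k : ℕ => p k * Real.exp (ρ * k)) ∧ ρ * v / 2 ≤ gwPhi p ρ := by
  have hφ : 1 - Real.exp (-s) ≤ gwPhi p θ := by
    have h1 := hp.summable_s12.hasSum
    rw [hp.total] at h1
    have h2 := h1.sub (hθ.hasSum.mul_right (Real.exp (-θ)))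
    have h3 : HasSum (fun k : ℕ => p k * (1 - Real.exp (θ * ((k : ℝ) - 1)))) (1 -
        (∑' k : ℕ, p k * Real.exp (θ * k)) * Real.exp (-θ)) := by
      refine h2.congr_fun fun k => ?_
      rw [mul_assoc, ← Real.exp_add]
      ring_nf
    rw [gwPhi, h3.tsum_eq]
    have h4 : Real.exp (θ - s) * Real.exp (-θ) = Real.exp (-s) := by
      rw [← Real.exp_add]; ring_nf
    nlinarith [mul_le_mul_of_nonneg_right hθs (Real.exp_pos (-θ)).le]
  have hθ0 : 0 < θ := by
    have h1 := hp.phi_le hθ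
    have h2 : Real.exp (-s) < 1 := Real.exp_lt_one_iff.2 (by linarith)
    have := hp.v_pos
    by_contra h
    nlinarith
  have hsθ : s ≤ θ := by
    have h1 : 1 ≤ ∑' k : ℕ, p k * Real.exp (θ * k) := by
      rw [← hp.total]
      refine hp.summable_s12.tsum_le_tsum (fun k => ?_) hθ
      exact le_mul_of_one_le_right (hp.nonneg k) (Real.one_le_exp (by positivity))
    have := (Real.one_le_exp_iff).1 (h1.trans hθs)
    linarith
  have hρθ : ρ < θ := hρs.trans_le hsθ
  refine ⟨summable_exp_of_le hp hρθ.le hθ, ?_⟩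
  have hne : {ρ : ℝ | 0 < ρ ∧ ρ * gwGamma p ρ ≤ v}.Nonempty := by
    by_contra h
    rw [Set.not_nonempty_iff_eq_empty] at h
    rw [gwBeta, h, Real.sSup_empty] at hρβ
    linarith
  obtain ⟨ρ₁, ⟨h0, hΓ⟩, hlt⟩ := exists_lt_of_lt_csSup hne hρβ
  by_cases hsum : Summable fun ℓ : ℕ =>
      p (ℓ + 2) * ((ℓ : ℝ) + 1) ^ 2 * Real.exp (ρ₁ * ((ℓ : ℝ) + 1))
  · obtain ⟨h1, h2⟩ := gamma_mono hp hlt.le hsum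
    refine hp.half_le_phi_of_gamma hρ.le (summable_exp_of_le hp hρθ.le hθ) h1 ?_
    refine le_trans ?_ hΓ
    have : 0 ≤ gwGamma p ρ := add_nonneg (hp.nonneg 0) (tsum_nonneg fun ℓ =>
      mul_nonneg (mul_nonneg (hp.nonneg _) (by positivity)) (Real.exp_pos _).le)
    calc ρ * gwGamma p ρ ≤ ρ₁ * gwGamma p ρ := by gcongr
      _ ≤ _ := by gcongr
  · have h1 : θ ≤ ρ₁ := by
      by_contra h
      exact hsum (summable_gamma_of_lt hp (not_le.1 h) hθ)
    have h2 : ρ₁ ≤ 1 := by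
      rw [gwGamma, tsum_eq_zero_of_not_summable hsum, add_zero] at hΓ
      have := hp.v_le_s12
      have := hp.v_pos
      by_contra h
      nlinarith
    refine hp.half_le_phi_of_le_one hρ hρθ (h1.trans h2) hθ (le_trans ?_ hφ)
    have : Real.exp (-s) ≤ Real.exp (-ρ) := Real.exp_le_exp.2 (by linarith)
    linarith

end OffspringLaw

section BirthCounter

open scoped ENNReal NNReal

lemma MarkovSemigroup.integral_add {S : Type*} [MeasurableSpace S] [DiscreteMeasurableSpace S]
    (K : MarkovSemigroup S) {f : S → ℝ} (h0 : ∀ x, 0 ≤ f x) {C : ℝ} (hC : ∀ x, f x ≤ C)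
    {s t : ℝ} (hs : 0 ≤ s) (ht : 0 ≤ t) (x : S) :
    ∫ y, f y ∂K.P (s + t) x = ∫ z, (∫ y, f y ∂K.P t z) ∂K.P s x := by
  have hfin : ∀ z, ENNReal.ofReal (∫ y, f y ∂K.P t z) = ∫⁻ y, ENNReal.ofReal (f y) ∂K.P t z := by
    intro z
    have := K.prob t z
    refine ofReal_integral_eq_lintegral_ofReal ?_ (.of_forall h0)
    exact Integrable.of_bound Measurable.of_discrete.aestronglyMeasurable C
      (.of_forall fun y => by rw [Real.norm_of_nonneg (h0 y)]; exact hC y)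
  rw [integral_eq_lintegral_of_nonneg_ae (.of_forall h0)
      Measurable.of_discrete.aestronglyMeasurable,
    integral_eq_lintegral_of_nonneg_ae (.of_forall fun z => integral_nonneg h0)
      Measurable.of_discrete.aestronglyMeasurable, K.semigroup s t hs ht x,
    Measure.lintegral_bind (K.meas t).aemeasurable Measurable.of_discrete.aemeasurable]
  simp only [hfin]

lemma MarkovSemigroup.integral_mem_Icc {S : Type*} [MeasurableSpace S]
    [DiscreteMeasurableSpace S] (K : MarkovSemigroup S) {f : S → ℝ} (h0 : ∀ x, 0 ≤ f x) {C : ℝ}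
    (hC : ∀ x, f x ≤ C) (t : ℝ) (x : S) : ∫ y, f y ∂K.P t x ∈ Icc 0 C := by
  have := K.prob t x
  refine ⟨integral_nonneg h0, ?_⟩
  calc ∫ y, f y ∂K.P t x ≤ ∫ _, C ∂K.P t x := by
        refine integral_mono ?_ (integrable_const C) hC
        exact Integrable.of_bound Measurable.of_discrete.aestronglyMeasurable C
          (.of_forall fun y => by rw [Real.norm_of_nonneg (h0 y)]; exact hC y)
    _ = C := by simp

/-- The truncated exponential of the birth counter. -/
def expBirths (s : ℝ) (n : ℕ) (w : ℕ × ℕ) : ℝ := Real.exp (s * (min w.2 n : ℕ))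

/-- The long-time limit of the expectation of the truncated exponential of the birth counter. -/
def expBirthsLimit (W : MarkovSemigroup (ℕ × ℕ)) (s : ℝ) (n : ℕ) (w : ℕ × ℕ) : ℝ :=
  ⨆ t : ℝ≥0, ∫ z, expBirths s n z ∂W.P t w

variable {p : ℕ → ℝ} {σ v s : ℝ} {W : MarkovSemigroup (ℕ × ℕ)}

lemma expBirths_nonneg (s : ℝ) (n : ℕ) (w : ℕ × ℕ) : 0 ≤ expBirths s n w := (Real.exp_pos _).le

lemma expBirths_le (hs : 0 ≤ s) (n : ℕ) (w : ℕ × ℕ) : expBirths s n w ≤ Real.exp (s * n) :=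
  Real.exp_le_exp.2 (mul_le_mul_of_nonneg_left (by exact_mod_cast min_le_right _ _) hs)

lemma expBirths_bounded (hs : 0 ≤ s) (n : ℕ) : Bounded (expBirths s n) :=
  ⟨_, fun w => by rw [abs_of_nonneg (expBirths_nonneg s n w)]; exact expBirths_le hs n w⟩

lemma gwbGen_expBirths_nonneg (hp : ∀ k, 0 ≤ p k) (hs : 0 ≤ s) (n : ℕ) (w : ℕ × ℕ) :
    0 ≤ gwbGen p (expBirths s n) w := by
  refine tsum_nonneg fun k => mul_nonneg (mul_nonneg (Nat.cast_nonneg _) (hp k)) (sub_nonneg.2 ?_)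
  refine Real.exp_le_exp.2 (mul_le_mul_of_nonneg_left ?_ hs)
  exact_mod_cast min_le_min_right n (Nat.le_add_right _ _)

/-- Kolmogorov's backward equation. -/
lemma IsGWBSemigroup.backward (hW : IsGWBSemigroup p W) {f : ℕ × ℕ → ℝ} (h0 : ∀ w, 0 ≤ f w)
    {C : ℝ} (hC : ∀ w, f w ≤ C) (w : ℕ × ℕ) {t : ℝ} (ht : 0 ≤ t) :
    HasDerivWithinAt (fun u => ∫ z, f z ∂W.P u w)
      (gwbGen p (fun w' => ∫ z, f z ∂W.P t w') w) (Ici t) t := by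
  have hb : Bounded fun w' => ∫ z, f z ∂W.P t w' :=
    ⟨C, fun w' => abs_le.2 ⟨by
      have := W.integral_mem_Icc h0 hC t w'
      linarith [this.1, this.2], (W.integral_mem_Icc h0 hC t w').2⟩⟩
  have h1 := hW _ hb w 0 le_rfl
  rw [W.init, integral_dirac, ← sub_self t] at h1
  have h1' : HasDerivWithinAt _ _ (Ici (t - t)) ((fun u => u - t) t) := h1
  have h2 := HasDerivWithinAt.comp (h := fun u => u - t) (s' := Ici (t - t)) t h1'
    ((hasDerivWithinAt_id t (Ici t)).sub_const t) (fun u hu => sub_le_sub_right hu t)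
  rw [mul_one] at h2
  refine h2.congr (fun u hu => ?_) ?_
  · have := W.integral_add h0 hC (sub_nonneg.2 (mem_Ici.1 hu)) ht w
    simpa using this
  · have := W.integral_add h0 hC (sub_nonneg.2 (le_refl t)) ht w
    simpa using this

lemma expBirths_integral_mono (hp : ∀ k, 0 ≤ p k) (hW : IsGWBSemigroup p W) (hs : 0 ≤ s) (n : ℕ)
    (w : ℕ × ℕ) : MonotoneOn (fun t => ∫ z, expBirths s n z ∂W.P t w) (Ici 0) := by
  have hd := hW _ (expBirths_bounded hs n) w
  refine monotoneOn_of_hasDerivWithinAt_nonneg (convex_Ici 0)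
    (fun t ht => (hd t ht).continuousWithinAt)
    (fun t ht => (hd t (interior_subset ht)).mono interior_subset)
    (fun t _ => integral_nonneg (gwbGen_expBirths_nonneg hp hs n))

lemma tendsto_expBirthsLimit (hp : ∀ k, 0 ≤ p k) (hW : IsGWBSemigroup p W) (hs : 0 ≤ s) (n : ℕ)
    (w : ℕ × ℕ) : Tendsto (fun t : ℝ≥0 => ∫ z, expBirths s n z ∂W.P t w) atTop
      (𝓝 (expBirthsLimit W s n w)) := by
  refine tendsto_atTop_ciSup (fun a b hab => expBirths_integral_mono hp hW hs n w a.2 b.2 hab)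
    ⟨Real.exp (s * n), ?_⟩
  rintro _ ⟨t, rfl⟩
  exact (W.integral_mem_Icc (expBirths_nonneg s n) (expBirths_le hs n) t w).2

lemma expBirthsLimit_mem_Icc (hp : ∀ k, 0 ≤ p k) (hW : IsGWBSemigroup p W) (hs : 0 ≤ s) (n : ℕ)
    (w : ℕ × ℕ) : expBirthsLimit W s n w ∈ Icc 0 (Real.exp (s * n)) :=
  isClosed_Icc.mem_of_tendsto (tendsto_expBirthsLimit hp hW hs n w)
    (.of_forall fun t => W.integral_mem_Icc (expBirths_nonneg s n) (expBirths_le hs n) t w)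

lemma le_expBirthsLimit (hp : ∀ k, 0 ≤ p k) (hW : IsGWBSemigroup p W) (hs : 0 ≤ s) (n : ℕ)
    (w : ℕ × ℕ) : expBirths s n w ≤ expBirthsLimit W s n w := by
  refine ge_of_tendsto (tendsto_expBirthsLimit hp hW hs n w) (.of_forall fun t => ?_)
  have h := expBirths_integral_mono hp hW hs n w (mem_Ici.2 le_rfl) t.2 t.2
  simpa [W.init, integral_dirac] using h

lemma expBirthsLimit_mono (hp : ∀ k, 0 ≤ p k) (hW : IsGWBSemigroup p W) (hs : 0 ≤ s)
    (w : ℕ × ℕ) : Monotone fun n => expBirthsLimit W s n w := by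
  intro m n hmn
  refine le_of_tendsto_of_tendsto' (tendsto_expBirthsLimit hp hW hs m w)
    (tendsto_expBirthsLimit hp hW hs n w) fun t => ?_
  have := W.prob t w
  have hi : ∀ n, Integrable (expBirths s n) (W.P t w) := fun n =>
    Integrable.of_bound Measurable.of_discrete.aestronglyMeasurable (Real.exp (s * n))
      (.of_forall fun z => by
        rw [Real.norm_of_nonneg (expBirths_nonneg s n z)]; exact expBirths_le hs n z)
  refine integral_mono (hi m) (hi n) fun z => Real.exp_le_exp.2 ?_
  exact mul_le_mul_of_nonneg_left (by exact_mod_cast min_le_min_left _ hmn) hs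

lemma gwbGen_expBirthsLimit_nonpos (hp : OffspringLaw p σ v) (hW : IsGWBSemigroup p W)
    (hs : 0 ≤ s) (n : ℕ) (w : ℕ × ℕ) : gwbGen p (expBirthsLimit W s n) w ≤ 0 := by
  set φ : ℝ → ℕ × ℕ → ℝ := fun t w => ∫ z, expBirths s n z ∂W.P t w with hφ
  have hmem : ∀ t w, φ t w ∈ Icc 0 (Real.exp (s * n)) := fun t w =>
    W.integral_mem_Icc (expBirths_nonneg s n) (expBirths_le hs n) t w
  have hlim : Tendsto (fun t : ℝ≥0 => gwbGen p (φ t) w) atTop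
      (𝓝 (gwbGen p (expBirthsLimit W s n) w)) := by
    refine tendsto_tsum_of_dominated_convergence
      (bound := fun k => (w.1 : ℝ) * p k * Real.exp (s * n)) ((hp.summable_s12.mul_left _).mul_right _)
      (fun k => ((tendsto_expBirthsLimit hp.nonneg hW hs n _).sub
        (tendsto_expBirthsLimit hp.nonneg hW hs n _)).const_mul _) (.of_forall fun t k => ?_)
    have h0 := mul_nonneg (Nat.cast_nonneg (α := ℝ) w.1) (hp.nonneg k)
    rw [norm_mul, Real.norm_of_nonneg h0]
    refine mul_le_mul_of_nonneg_left (abs_le.2 ?_) h0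
    have h1 := hmem t (w.1 + k - 1, w.2 + k)
    have h2 := hmem t w
    constructor <;> linarith [h1.1, h1.2, h2.1, h2.2]
  by_contra! hpos
  set δ := gwbGen p (expBirthsLimit W s n) w / 2 with hδ
  have hδ0 : 0 < δ := by positivity
  obtain ⟨T, hT⟩ := eventually_atTop.1 (hlim.eventually (lt_mem_nhds (half_lt_self hpos)))
  have hd : ∀ t, 0 ≤ t → HasDerivWithinAt (fun u => φ u w) (gwbGen p (φ t) w) (Ici 0) t := by
    intro t ht
    have h1 := hW _ (expBirths_bounded hs n) w t ht
    have h2 := hW.backward (expBirths_nonneg s n) (expBirths_le hs n) w ht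
    rw [← (uniqueDiffWithinAt_Ici t).eq_deriv _ (h1.mono (Ici_subset_Ici.2 ht)) h2]
    exact h1
  have hmono : MonotoneOn (fun u => φ u w - u * δ) (Ici (T : ℝ)) := by
    have hd' : ∀ t ∈ Ici (T : ℝ), HasDerivWithinAt (fun u => φ u w - u * δ)
        (gwbGen p (φ t) w - 1 * δ) (Ici (T : ℝ)) t := fun t ht =>
      ((hd t (T.2.trans ht)).mono (Ici_subset_Ici.2 T.2)).sub
        ((hasDerivWithinAt_id t _).mul_const δ)
    refine monotoneOn_of_hasDerivWithinAt_nonneg (convex_Ici _)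
      (fun t ht => (hd' t ht).continuousWithinAt)
      (fun t ht => (hd' t (interior_subset ht)).mono interior_subset) fun t ht => ?_
    have ht' : (T : ℝ) ≤ t := interior_subset ht
    have := hT ⟨t, T.2.trans ht'⟩ ht'
    rw [one_mul, sub_nonneg]
    exact this.le
  have h0 : 0 ≤ (Real.exp (s * n) + 1) / δ := by positivity
  have h1 := hmono (mem_Ici.2 le_rfl) (mem_Ici.2 (le_add_of_nonneg_right h0))
    (le_add_of_nonneg_right h0)
  have h2 : (Real.exp (s * n) + 1) / δ * δ = Real.exp (s * n) + 1 := div_mul_cancel₀ _ hδ0.ne'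
  have h3 := hmem T w
  have h4 := hmem (T + (Real.exp (s * n) + 1) / δ) w
  simp only [add_mul, h2] at h1
  linarith [h3.1, h4.2]

lemma tsum_ofReal_mul_expBirthsLimit_le (hp : OffspringLaw p σ v) (hW : IsGWBSemigroup p W)
    (hs : 0 ≤ s) (n z b : ℕ) :
    ∑' k, ENNReal.ofReal (p k) * ENNReal.ofReal (expBirthsLimit W s n (z + k, b + k)) ≤
      ENNReal.ofReal (expBirthsLimit W s n (z + 1, b)) := by
  have hmem := expBirthsLimit_mem_Icc hp.nonneg hW hs n
  have hsum : Summable fun k => p k * expBirthsLimit W s n (z + k, b + k) :=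
    (hp.summable_s12.mul_right (Real.exp (s * n))).of_nonneg_of_le
      (fun k => mul_nonneg (hp.nonneg k) (hmem _).1)
      fun k => mul_le_mul_of_nonneg_left (hmem _).2 (hp.nonneg k)
  simp only [← ENNReal.ofReal_mul (hp.nonneg _)]
  rw [← ENNReal.ofReal_tsum_of_nonneg (fun k => mul_nonneg (hp.nonneg k) (hmem _).1) hsum]
  refine ENNReal.ofReal_le_ofReal ?_
  have h1 := hp.summable_s12.hasSum
  rw [hp.total] at h1
  have h2 : HasSum (fun k => ((z + 1 : ℕ) : ℝ) * p k *
      (expBirthsLimit W s n (z + 1 + k - 1, b + k) - expBirthsLimit W s n (z + 1, b)))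
      (((z + 1 : ℕ) : ℝ) * ((∑' k, p k * expBirthsLimit W s n (z + k, b + k)) -
        1 * expBirthsLimit W s n (z + 1, b))) := by
    refine ((hsum.hasSum.sub (h1.mul_right _)).mul_left _).congr_fun fun k => ?_
    rw [show z + 1 + k - 1 = z + k by omega]
    ring
  have h3 := gwbGen_expBirthsLimit_nonpos hp hW hs n (z + 1, b)
  rw [gwbGen, h2.tsum_eq] at h3
  have h4 := nonpos_of_mul_nonpos_right h3 (by positivity)
  linarith

/-- The generating function, with weight `e^{s k}` for a birth of `k` children, of the
first passage at `0` within `m` steps of the embedded walk started at `z`. -/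
def passageWeight (p : ℕ → ℝ) (s : ℝ) : ℕ → ℕ → ℝ≥0∞
  | 0, 0 => 1
  | 0, _ + 1 => 0
  | _ + 1, 0 => 1
  | m + 1, z + 1 => ∑' k : ℕ, ENNReal.ofReal (p k * Real.exp (s * k)) * passageWeight p s m (z + k)

lemma passageWeight_zero (m : ℕ) : passageWeight p s m 0 = 1 := by
  cases m <;> simp [passageWeight]

lemma passageWeight_le_succ (m z : ℕ) :
    passageWeight p s m z ≤ passageWeight p s (m + 1) z := by
  induction m generalizing z with
  | zero => cases z <;> simp [passageWeight]
  | succ m ih =>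
    cases z with
    | zero => simp [passageWeight]
    | succ z =>
      rw [passageWeight, passageWeight]
      exact ENNReal.tsum_le_tsum fun k => mul_le_mul_right (ih _) _

lemma passageWeight_mono (z : ℕ) : Monotone fun m => passageWeight p s m z :=
  monotone_nat_of_le_succ fun m => passageWeight_le_succ m z

lemma passageWeight_mul_le (m n y z : ℕ) :
    passageWeight p s m y * passageWeight p s n z ≤ passageWeight p s (m + n) (y + z) := by
  induction m generalizing y with
  | zero => cases y <;> simp [passageWeight]
  | succ m ih =>
    cases y with
    | zero =>
      rw [passageWeight_zero, one_mul, zero_add]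
      exact passageWeight_mono z (by omega)
    | succ y =>
      rw [show m + 1 + n = m + n + 1 by omega, show y + 1 + z = y + z + 1 by omega,
        passageWeight, passageWeight, ← ENNReal.tsum_mul_right]
      refine ENNReal.tsum_le_tsum fun k => ?_
      rw [mul_assoc, show y + z + k = y + k + z by omega]
      exact mul_le_mul_right (ih _) _

lemma passageWeight_pow_le (m k : ℕ) :
    passageWeight p s m 1 ^ k ≤ passageWeight p s (m * k) k := by
  induction k with
  | zero => simp [passageWeight]
  | succ k ih =>
    rw [pow_succ]
    calc _ ≤ passageWeight p s (m * k) k * passageWeight p s m 1 := by gcongr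
      _ ≤ _ := passageWeight_mul_le _ _ _ _

lemma passageWeight_mul_exp_le (hp : OffspringLaw p σ v) (hW : IsGWBSemigroup p W) (hs : 0 ≤ s)
    (m z b : ℕ) : passageWeight p s m z * ENNReal.ofReal (Real.exp (s * b)) ≤
      ⨆ n, ENNReal.ofReal (expBirthsLimit W s n (z, b)) := by
  have hbase : ∀ b : ℕ, ENNReal.ofReal (Real.exp (s * b)) ≤
      ⨆ n, ENNReal.ofReal (expBirthsLimit W s n (0, b)) := fun b => by
    refine le_iSup_of_le b (ENNReal.ofReal_le_ofReal ?_)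
    have := le_expBirthsLimit hp.nonneg hW hs b (0, b)
    simpa [expBirths] using this
  induction m generalizing z b with
  | zero =>
    cases z with
    | zero => simpa [passageWeight] using hbase b
    | succ z => simp [passageWeight]
  | succ m ih =>
    cases z with
    | zero => simpa [passageWeight] using hbase b
    | succ z =>
      rw [passageWeight, ← ENNReal.tsum_mul_right]
      calc _ ≤ ∑' k, ⨆ n, ENNReal.ofReal (p k) *
              ENNReal.ofReal (expBirthsLimit W s n (z + k, b + k)) := by
            refine ENNReal.tsum_le_tsum fun k => ?_
            rw [← ENNReal.mul_iSup]
            refine le_trans (le_of_eq ?_) (mul_le_mul_right (ih (z + k) (b + k)) _)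
            rw [ENNReal.ofReal_mul (hp.nonneg k)]
            have : Real.exp (s * (b + k : ℕ)) = Real.exp (s * k) * Real.exp (s * b) := by
              rw [← Real.exp_add]; push_cast; ring_nf
            rw [this, ENNReal.ofReal_mul (Real.exp_pos _).le]
            ring
        _ = ⨆ n, ∑' k, ENNReal.ofReal (p k) *
              ENNReal.ofReal (expBirthsLimit W s n (z + k, b + k)) := by
            simp only [← lintegral_count]
            refine lintegral_iSup (fun n => Measurable.of_discrete) fun m n hmn k => ?_
            exact mul_le_mul_right (ENNReal.ofReal_le_ofReal
              (expBirthsLimit_mono hp.nonneg hW hs _ hmn)) _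
        _ ≤ _ := iSup_mono fun n => tsum_ofReal_mul_expBirthsLimit_le hp hW hs n z b

lemma passageWeight_one_le (hp : OffspringLaw p σ v) (hW : IsGWBSemigroup p W) (hs : 0 ≤ s)
    {M : ℝ} (hM : ∀ t : ℝ, 0 ≤ t →
      ∫⁻ w, ENNReal.ofReal (Real.exp (s * (1 + (w.2 : ℝ)))) ∂W.P t (1, 0) ≤ ENNReal.ofReal M)
    (m : ℕ) : passageWeight p s m 1 ≤ ENNReal.ofReal M := by
  have h := passageWeight_mul_exp_le hp hW hs m 1 0
  simp only [Nat.cast_zero, mul_zero, Real.exp_zero, ENNReal.ofReal_one, mul_one] at h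
  refine h.trans (iSup_le fun n => ?_)
  have hlim := (ENNReal.continuous_ofReal.tendsto _).comp
    (tendsto_expBirthsLimit hp.nonneg hW hs n (1, 0))
  refine le_of_tendsto hlim (.of_forall fun t => le_trans ?_ (hM t t.2))
  have := W.prob t (1, 0)
  simp only [Function.comp_apply]
  rw [ofReal_integral_eq_lintegral_ofReal ?_ (.of_forall (expBirths_nonneg s n))]
  · refine lintegral_mono fun w => ENNReal.ofReal_le_ofReal (Real.exp_le_exp.2 ?_)
    refine mul_le_mul_of_nonneg_left ?_ hs
    have : ((min w.2 n : ℕ) : ℝ) ≤ w.2 := by exact_mod_cast min_le_left _ _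
    linarith
  · exact Integrable.of_bound Measurable.of_discrete.aestronglyMeasurable (Real.exp (s * n))
      (.of_forall fun z => by
        rw [Real.norm_of_nonneg (expBirths_nonneg s n z)]; exact expBirths_le hs n z)

/-- Finiteness of `E e^{s H}` forces `e^θ ≥ e^s g(e^θ)` for some `θ`, where `g` is the offspring
generating function. -/
lemma exists_exponent_of_hMomentFinite (hp : OffspringLaw p σ v) (hW : IsGWBSemigroup p W)
    (hs : 0 ≤ s) (hH : HMomentFinite W s) :
    ∃ θ : ℝ, (Summable fun k : ℕ => p k * Real.exp (θ * k)) ∧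
      ∑' k : ℕ, p k * Real.exp (θ * k) ≤ Real.exp (θ - s) := by
  obtain ⟨M, hM⟩ := hH
  set h : ℝ≥0∞ := ⨆ m, passageWeight p s m 1 with hh
  have hle : h ≤ ENNReal.ofReal M := iSup_le (passageWeight_one_le hp hW hs hM)
  have htop : h ≠ ∞ := (hle.trans_lt ENNReal.ofReal_lt_top).ne
  have hpos : h ≠ 0 := by
    have h1 : ENNReal.ofReal (p 0) ≤ h := by
      refine le_trans ?_ (le_iSup _ 1)
      rw [passageWeight]
      refine le_trans (le_of_eq ?_) (ENNReal.le_tsum 0)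
      simp [passageWeight]
    have h2 := ENNReal.ofReal_pos.2 (hp.v_pos.trans_le hp.v_le_s12)
    exact (h2.trans_le h1).ne'
  have htend : Tendsto (fun m => passageWeight p s m 1) atTop (𝓝 h) :=
    tendsto_atTop_iSup (passageWeight_mono 1)
  have hfix : ∑' k : ℕ, ENNReal.ofReal (p k * Real.exp (s * k)) * h ^ k ≤ h := by
    rw [ENNReal.tsum_eq_iSup_nat]
    refine iSup_le fun K => ?_
    refine le_of_tendsto (tendsto_finsetSum _ fun k _ => ENNReal.Tendsto.const_mul
      (ENNReal.Tendsto.pow htend) (Or.inr ENNReal.ofReal_ne_top)) (.of_forall fun m => ?_)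
    calc _ ≤ ∑ k ∈ Finset.range K, ENNReal.ofReal (p k * Real.exp (s * k)) *
            passageWeight p s (m * K) (0 + k) := by
          refine Finset.sum_le_sum fun k hk => mul_le_mul_right ?_ _
          rw [zero_add]
          exact (passageWeight_pow_le m k).trans (passageWeight_mono k
            (Nat.mul_le_mul_left m (Finset.mem_range.1 hk).le))
      _ ≤ passageWeight p s (m * K + 1) (0 + 1) := by
          rw [passageWeight]; exact ENNReal.sum_le_tsum _
      _ ≤ h := le_iSup (fun m => passageWeight p s m 1) _
  have hx : 0 < h.toReal := ENNReal.toReal_pos hpos htop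
  refine ⟨s + Real.log h.toReal, ?_⟩
  have hexp : Real.exp (Real.log h.toReal) = h.toReal := Real.exp_log hx
  have hterm : ∀ k : ℕ, ENNReal.ofReal (p k * Real.exp ((s + Real.log h.toReal) * k)) =
      ENNReal.ofReal (p k * Real.exp (s * k)) * h ^ k := fun k => by
    have : Real.exp ((s + Real.log h.toReal) * k) = Real.exp (s * k) * h.toReal ^ k := by
      rw [← hexp, ← Real.exp_nat_mul, hexp, ← Real.exp_add]; ring_nf
    rw [this, ← mul_assoc, ENNReal.ofReal_mul (mul_nonneg (hp.nonneg k) (Real.exp_pos _).le),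
      ENNReal.ofReal_pow hx.le, ENNReal.ofReal_toReal htop]
  have hnn : ∀ k : ℕ, 0 ≤ p k * Real.exp ((s + Real.log h.toReal) * k) := fun k =>
    mul_nonneg (hp.nonneg k) (Real.exp_pos _).le
  have hsum : Summable fun k : ℕ => p k * Real.exp ((s + Real.log h.toReal) * k) := by
    refine (ENNReal.summable_toReal (f := fun k => ENNReal.ofReal _) ?_).congr
      fun k => ENNReal.toReal_ofReal (hnn k)
    simp only [hterm]
    exact (hfix.trans_lt htop.lt_top).ne
  refine ⟨hsum, ?_⟩
  rw [add_sub_cancel_left, hexp, ← ENNReal.ofReal_le_iff_le_toReal htop,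
    ENNReal.ofReal_tsum_of_nonneg hnn hsum]
  simpa only [hterm] using hfix

end BirthCounter


section Reflected

/-- The truncated exponential. -/
def expTrunc (ρ : ℝ) (n y : ℕ) : ℝ := Real.exp (ρ * (min y n : ℕ))

variable {p : ℕ → ℝ} {σ v ρ : ℝ} {R : MarkovSemigroup ℕ}

lemma expTrunc_nonneg (ρ : ℝ) (n y : ℕ) : 0 ≤ expTrunc ρ n y := (Real.exp_pos _).le

lemma expTrunc_le (hρ : 0 ≤ ρ) (n y : ℕ) : expTrunc ρ n y ≤ Real.exp (ρ * n) :=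
  Real.exp_le_exp.2 (mul_le_mul_of_nonneg_left (by exact_mod_cast min_le_right _ _) hρ)

lemma expTrunc_le_exp (hρ : 0 ≤ ρ) (n y : ℕ) : expTrunc ρ n y ≤ Real.exp (ρ * y) :=
  Real.exp_le_exp.2 (mul_le_mul_of_nonneg_left (by exact_mod_cast min_le_left _ _) hρ)

lemma expTrunc_of_le {n y : ℕ} (h : y ≤ n) : expTrunc ρ n y = Real.exp (ρ * y) := by
  rw [expTrunc, min_eq_left h]

lemma expTrunc_of_ge {n y : ℕ} (h : n ≤ y) : expTrunc ρ n y = Real.exp (ρ * n) := by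
  rw [expTrunc, min_eq_right h]

lemma expTrunc_bounded (hρ : 0 ≤ ρ) (n : ℕ) : Bounded (expTrunc ρ n) :=
  ⟨_, fun y => by rw [abs_of_nonneg (expTrunc_nonneg ρ n y)]; exact expTrunc_le hρ n y⟩

lemma integrable_expTrunc (hρ : 0 ≤ ρ) (n : ℕ) (t : ℝ) (x : ℕ) :
    Integrable (expTrunc ρ n) (R.P t x) := by
  have := R.prob t x
  exact Integrable.of_bound Measurable.of_discrete.aestronglyMeasurable (Real.exp (ρ * n))
    (.of_forall fun y => by
      rw [Real.norm_of_nonneg (expTrunc_nonneg ρ n y)]; exact expTrunc_le hρ n y)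

lemma gwQRefl_expTrunc_of_lt {n y : ℕ} (h : n < y) : gwQRefl p (expTrunc ρ n) y = 0 := by
  refine (tsum_congr fun k => ?_).trans tsum_zero
  split_ifs
  · rw [expTrunc_of_ge h.le, expTrunc_of_ge (by omega), sub_self, mul_zero]
  · rw [mul_zero]

lemma integrable_gwQRefl_expTrunc (n : ℕ) (t : ℝ) (x : ℕ) :
    Integrable (gwQRefl p (expTrunc ρ n)) (R.P t x) := by
  have := R.prob t x
  refine Integrable.of_bound Measurable.of_discrete.aestronglyMeasurable
    (∑ i ∈ Finset.range (n + 1), |gwQRefl p (expTrunc ρ n) i|) (.of_forall fun y => ?_)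
  rw [Real.norm_eq_abs]
  by_cases h : n < y
  · rw [gwQRefl_expTrunc_of_lt h, abs_zero]
    exact Finset.sum_nonneg fun i _ => abs_nonneg _
  · exact Finset.single_le_sum (f := fun i => |gwQRefl p (expTrunc ρ n) i|)
      (fun i _ => abs_nonneg _) (Finset.mem_range.2 (by omega))

lemma gwQRefl_expTrunc_le (hp : OffspringLaw p σ v) (hρ : 0 < ρ)
    (hs : Summable fun k : ℕ => p k * Real.exp (ρ * k)) {c : ℝ} (hc : 0 ≤ c)
    (hφ : c ≤ gwPhi p ρ) {n y : ℕ} (hy : y ≤ n) :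
    gwQRefl p (expTrunc ρ n) y ≤ -c * expTrunc ρ n y + Real.exp ρ := by
  have hexp : 1 ≤ Real.exp ρ := Real.one_le_exp hρ.le
  rw [expTrunc_of_le hy]
  rcases Nat.eq_zero_or_pos y with rfl | hy0
  · have := hp.phi_le_one hs
    simp only [gwQRefl, Nat.cast_zero, zero_mul, tsum_zero, mul_zero, Real.exp_zero]
    linarith
  have hy1 : (1 : ℝ) ≤ y := by exact_mod_cast hy0
  have hE := Real.exp_pos (ρ * y)
  have hright := ((hp.hasSum_phi hs).mul_left (-(y * Real.exp (ρ * y)))).add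
    (hasSum_ite_eq (0 : ℕ) (Real.exp ρ - 1))
  have hleft : Summable fun k : ℕ => (y : ℝ) * p k *
      (if 1 ≤ y + k - 1 then expTrunc ρ n (y + k - 1) - expTrunc ρ n y else 0) := by
    refine Summable.of_norm_bounded ((hp.summable_s12.mul_left (y : ℝ)).mul_right (Real.exp (ρ * n)))
      fun k => ?_
    have h0 := mul_nonneg (Nat.cast_nonneg (α := ℝ) y) (hp.nonneg k)
    rw [norm_mul, Real.norm_of_nonneg h0]
    refine mul_le_mul_of_nonneg_left (abs_le.2 ?_) h0
    have h1 := expTrunc_nonneg ρ n (y + k - 1)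
    have h2 := expTrunc_nonneg ρ n y
    have h3 := expTrunc_le hρ.le n (y + k - 1)
    have h4 := expTrunc_le hρ.le n y
    split_ifs <;> constructor <;> linarith
  have key := hasSum_le (fun k => ?_) hleft.hasSum hright
  · rw [gwQRefl]
    have h1 : c * Real.exp (ρ * y) ≤ y * Real.exp (ρ * y) * gwPhi p ρ := by
      calc c * Real.exp (ρ * y) ≤ gwPhi p ρ * Real.exp (ρ * y) := by gcongr
        _ = 1 * (gwPhi p ρ * Real.exp (ρ * y)) := (one_mul _).symm
        _ ≤ y * (gwPhi p ρ * Real.exp (ρ * y)) := by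
            gcongr
            exact mul_nonneg (hc.trans hφ) hE.le
        _ = _ := by ring
    linarith
  · have hpk := hp.nonneg k
    by_cases h : 1 ≤ y + k - 1
    · have h0 : 0 ≤ if k = 0 then Real.exp ρ - 1 else 0 := by split_ifs <;> linarith
      have h1 : expTrunc ρ n (y + k - 1) ≤ Real.exp (ρ * y) * Real.exp (ρ * ((k : ℝ) - 1)) := by
        refine (expTrunc_le_exp hρ.le _ _).trans (le_of_eq ?_)
        rw [← Real.exp_add, Nat.cast_sub (by omega)]
        push_cast
        ring_nf
      rw [if_pos h, expTrunc_of_le hy]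
      have h2 := mul_le_mul_of_nonneg_left h1 (mul_nonneg (Nat.cast_nonneg (α := ℝ) y) hpk)
      linarith
    · obtain rfl : y = 1 := by omega
      obtain rfl : k = 0 := by omega
      have h1 : Real.exp ρ * Real.exp (-ρ) = 1 := by rw [← Real.exp_add]; simp
      have h2 := hp.le_one 0
      rw [if_neg h, if_pos rfl]
      simp only [Nat.cast_one, Nat.cast_zero, zero_sub, mul_neg, mul_one, one_mul, mul_zero]
      nlinarith

/-- Exponential moments of the reflected process grow at most linearly in time. -/
lemma integral_expTrunc_le (hp : OffspringLaw p σ v) (hR : IsReflSemigroup p R) (hρ : 0 < ρ)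
    (hs : Summable fun k : ℕ => p k * Real.exp (ρ * k)) (hφ : 0 ≤ gwPhi p ρ) (n x : ℕ) {t : ℝ}
    (ht : 0 ≤ t) : ∫ y, expTrunc ρ n y ∂ R.P t x ≤ Real.exp (ρ * x) + t * Real.exp ρ := by
  have h := le_of_deriv_right_le_affine (K := Real.exp ρ) le_rfl (Real.exp_pos _).le ht
    (hR _ (expTrunc_bounded hρ.le n) x) fun u _ _ => ?_
  · refine h.trans ?_
    simp only [neg_zero, zero_mul, Real.exp_zero, one_mul, R.init, integral_dirac]
    exact add_le_add_left (expTrunc_le_exp hρ.le n x) _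
  · have := R.prob u x
    calc _ ≤ ∫ _, Real.exp ρ ∂ R.P u x := by
          refine integral_mono (integrable_gwQRefl_expTrunc n u x) (integrable_const _) fun y => ?_
          rcases le_or_gt y n with hy | hy
          · simpa using gwQRefl_expTrunc_le hp hρ hs le_rfl hφ hy
          · simpa only [gwQRefl_expTrunc_of_lt hy] using (Real.exp_pos ρ).le
      _ = _ := by simp

/-- The error made by truncating at level `n`, controlled by a higher exponential moment. -/
lemma gwQRefl_expTrunc_le_add (hp : OffspringLaw p σ v) (hρ : 0 < ρ)
    (hs : Summable fun k : ℕ => p k * Real.exp (ρ * k)) {c : ℝ} (hc : 0 ≤ c)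
    (hφ : c ≤ gwPhi p ρ) (ρ' : ℝ) (n y : ℕ) :
    gwQRefl p (expTrunc ρ n) y ≤ -c * expTrunc ρ n y + Real.exp ρ +
      c * Real.exp (-(ρ' - ρ) * n) * expTrunc ρ' n y := by
  have h0 : 0 ≤ c * Real.exp (-(ρ' - ρ) * n) * expTrunc ρ' n y :=
    mul_nonneg (mul_nonneg hc (Real.exp_pos _).le) (expTrunc_nonneg _ _ _)
  rcases le_or_gt y n with hy | hy
  · linarith [gwQRefl_expTrunc_le hp hρ hs hc hφ hy]
  · rw [gwQRefl_expTrunc_of_lt hy, expTrunc_of_ge hy.le, expTrunc_of_ge hy.le, mul_assoc,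
      ← Real.exp_add, show -(ρ' - ρ) * n + ρ' * n = ρ * n by ring]
    linarith [Real.exp_pos ρ]

lemma integral_expTrunc_le_add (hp : OffspringLaw p σ v) (hR : IsReflSemigroup p R) (hρ : 0 < ρ)
    {ρ' : ℝ} (hρρ' : ρ < ρ') (hs : Summable fun k : ℕ => p k * Real.exp (ρ' * k)) {c : ℝ}
    (hc : 0 ≤ c) (hφ : c ≤ gwPhi p ρ) (hφ' : 0 ≤ gwPhi p ρ') (n x : ℕ) {t : ℝ} (ht : 0 ≤ t) :
    ∫ y, expTrunc ρ n y ∂ R.P t x ≤ Real.exp (-c * t) * Real.exp (ρ * x) +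
      t * (Real.exp ρ + c * Real.exp (-(ρ' - ρ) * n) *
        (Real.exp (ρ' * x) + t * Real.exp ρ')) := by
  have hρ' := hρ.trans hρρ'
  have h := le_of_deriv_right_le_affine (K := Real.exp ρ + c * Real.exp (-(ρ' - ρ) * n) *
        (Real.exp (ρ' * x) + t * Real.exp ρ')) hc (by positivity) ht
    (hR _ (expTrunc_bounded hρ.le n) x) fun u hu hut => ?_
  · refine h.trans ?_
    simp only [R.init, integral_dirac]
    gcongr
    exact expTrunc_le_exp hρ.le n x
  · have := R.prob u x
    have hi := integrable_expTrunc (R := R) hρ.le n u x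
    have hi' := integrable_expTrunc (R := R) hρ'.le n u x
    have hA : Integrable (fun y => -c * expTrunc ρ n y + Real.exp ρ) (R.P u x) :=
      (hi.const_mul _).add (integrable_const _)
    have hB : Integrable (fun y => c * Real.exp (-(ρ' - ρ) * n) * expTrunc ρ' n y) (R.P u x) :=
      hi'.const_mul _
    have hmom : ∫ y, expTrunc ρ' n y ∂ R.P u x ≤ Real.exp (ρ' * x) + t * Real.exp ρ' := by
      refine (integral_expTrunc_le hp hR hρ' hs hφ' n x hu).trans ?_
      gcongr
    calc _ ≤ ∫ y, (-c * expTrunc ρ n y + Real.exp ρ +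
            c * Real.exp (-(ρ' - ρ) * n) * expTrunc ρ' n y) ∂ R.P u x :=
          integral_mono (integrable_gwQRefl_expTrunc n u x) (hA.add hB) fun y =>
            gwQRefl_expTrunc_le_add hp hρ (summable_exp_of_le hp hρρ'.le hs) hc hφ ρ' n y
      _ = -c * ∫ y, expTrunc ρ n y ∂ R.P u x + Real.exp ρ +
            c * Real.exp (-(ρ' - ρ) * n) * ∫ y, expTrunc ρ' n y ∂ R.P u x := by
          rw [integral_add hA hB, integral_add (hi.const_mul _) (integrable_const _),
            integral_const_mul, integral_const_mul]
          simp
      _ ≤ _ := by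
          rw [add_assoc]
          gcongr

lemma tendsto_integral_expTrunc (hρ : 0 ≤ ρ) (t : ℝ) (x : ℕ) :
    Tendsto (fun n => ENNReal.ofReal (∫ y, expTrunc ρ n y ∂ R.P t x)) atTop
      (𝓝 (∫⁻ y, ENNReal.ofReal (Real.exp (ρ * (y : ℝ))) ∂ R.P t x)) := by
  simp only [fun n => ofReal_integral_eq_lintegral_ofReal
    (integrable_expTrunc (R := R) hρ n t x) (.of_forall (expTrunc_nonneg ρ n))]
  refine lintegral_tendsto_of_tendsto_of_monotone
    (fun n => Measurable.of_discrete.aemeasurable) (.of_forall fun y m n hmn => ?_)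
    (.of_forall fun y => ?_)
  · refine ENNReal.ofReal_le_ofReal (Real.exp_le_exp.2 (mul_le_mul_of_nonneg_left ?_ hρ))
    exact_mod_cast min_le_min_left _ hmn
  · refine tendsto_const_nhds.congr' ?_
    filter_upwards [eventually_ge_atTop y] with n hn
    rw [expTrunc_of_le hn]

end Reflected

/-- **Exponential moment bound for the reflected Galton-Watson process.**
With `Γ(ρ) = p(0) + ∑_{ℓ≥1} p(ℓ+1) ℓ² e^{ρℓ}` and
`β = sup{ρ > 0 : ρΓ(ρ) ≤ v}`, for every `0 < ρ < min{β, σ'}`, `x ≥ 1` and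
`t ≥ 0`, `E exp(ρ Z̃^x_t) ≤ e^{-ρvt/2} e^{ρx} + t e^ρ`. -/
theorem gw_reflected_exp_moment
    (p : ℕ → ℝ) (σ v : ℝ) (hp : OffspringLaw p σ v)
    (W : MarkovSemigroup (ℕ × ℕ)) (hW : IsGWBSemigroup p W)
    (σ' : ℝ) (hσ' : 0 < σ') (hH : HMomentFinite W σ')
    (R : MarkovSemigroup ℕ) (hR : IsReflSemigroup p R)
    (ρ : ℝ) (hρ0 : 0 < ρ) (hρ : ρ < min (gwBeta p v) σ')
    (x : ℕ) (hx : 1 ≤ x) (t : ℝ) (ht : 0 ≤ t) :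
    ∫⁻ y, ENNReal.ofReal (Real.exp (ρ * (y : ℝ))) ∂ R.P t x ≤
      ENNReal.ofReal
        (Real.exp (-(ρ * v / 2) * t) * Real.exp (ρ * (x : ℝ)) + t * Real.exp ρ) := by
  obtain ⟨θ, hθ, hθs⟩ := exists_exponent_of_hMomentFinite hp hW hσ'.le hH
  obtain ⟨ρ', hρρ', hρ'⟩ := exists_between hρ
  obtain ⟨hρβ, hρσ⟩ := lt_min_iff.1 hρ
  obtain ⟨hρβ', hρσ'⟩ := lt_min_iff.1 hρ'
  have hv := hp.v_pos
  have hρ0' := hρ0.trans hρρ'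
  obtain ⟨-, hφ⟩ := hp.half_le_phi hθ hθs hρ0 hρβ hρσ
  obtain ⟨hs, hφ'⟩ := hp.half_le_phi hθ hθs hρ0' hρβ' hρσ'
  have hbound := fun n => ENNReal.ofReal_le_ofReal (integral_expTrunc_le_add hp hR hρ0 hρρ' hs
    (by positivity) hφ (le_trans (by positivity) hφ') n x ht)
  refine le_of_tendsto_of_tendsto' (tendsto_integral_expTrunc hρ0.le t x)
    ((ENNReal.continuous_ofReal.tendsto _).comp ?_) hbound
  have hexp : Tendsto (fun n : ℕ => Real.exp (-(ρ' - ρ) * n)) atTop (𝓝 0) :=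
    Real.tendsto_exp_atBot.comp
      (tendsto_natCast_atTop_atTop.const_mul_atTop_of_neg (by linarith))
  have := (((hexp.const_mul (ρ * v / 2)).mul_const
    (Real.exp (ρ' * x) + t * Real.exp ρ')).const_add (Real.exp ρ)).const_mul t
      |>.const_add (Real.exp (-(ρ * v / 2) * t) * Real.exp (ρ * x))
  simpa only [mul_zero, zero_mul, add_zero] using this

end
end

section
/- There is a constant κ > 0, independent of x, such that for every T ≥ 1/(16v) and every δ ≥ max{1, 4T p(0)}, the reflected Galton-Watson process satisfies the large deviation bound P( sup_{s<T} ( Z̃^x_s − e^{−vs} x ) ≥ δ ) ≤ exp( −(κ/T) · δ² / max{x, δ} ) for all x ∈ ℕ. -/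
open MeasureTheory Filter Topology Set

noncomputable section

/-- The integral over `ℕ` of a function that is constant from `N` on. -/
lemma integral_of_eventually_const (μ : Measure ℕ) [IsProbabilityMeasure μ] (f : ℕ → ℝ)
    (N : ℕ) (c : ℝ) (h : ∀ z, N ≤ z → f z = c) :
    ∫ y, f y ∂μ = c + ∑ z ∈ Finset.range N, (f z - c) * ∫ y, ({z} : Set ℕ).indicator 1 y ∂μ := by
  have hf : f = fun y => c + ∑ z ∈ Finset.range N, (f z - c) * ({z} : Set ℕ).indicator 1 y := by
    funext y
    by_cases hy : y < N
    · rw [Finset.sum_eq_single y]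
      · simp
      · intro z _ hz
        simp [Set.indicator, hz.symm]
      · intro hn
        exact absurd (Finset.mem_range.2 hy) hn
    · rw [Finset.sum_eq_zero, h y (not_lt.1 hy), add_zero]
      intro z hz
      have : y ≠ z := by have := Finset.mem_range.1 hz; omega
      simp [Set.indicator, this]
  have hi : ∀ z : ℕ, Integrable (({z} : Set ℕ).indicator (1 : ℕ → ℝ)) μ := fun z =>
    (integrable_const (1 : ℝ)).indicator (MeasurableSet.singleton z)
  conv_lhs => rw [hf]
  rw [integral_add (integrable_const _)
    (integrable_finsetSum _ fun z _ => (hi z).const_mul _),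
    integral_finsetSum _ fun z _ => (hi z).const_mul _]
  simp [integral_const_mul]

lemma bounded_of_eventually_const {f : ℕ → ℝ} {N : ℕ} {c : ℝ} (h : ∀ z, N ≤ z → f z = c) :
    ∃ C, ∀ z, |f z| ≤ C := by
  refine ⟨|c| + ∑ z ∈ Finset.range N, |f z|, fun z => ?_⟩
  by_cases hz : z < N
  · have := Finset.single_le_sum (f := fun z => |f z|) (fun i _ => abs_nonneg _)
      (Finset.mem_range.2 hz)
    have h0 := abs_nonneg c
    linarith
  · rw [h z (not_lt.1 hz)]
    have := Finset.sum_nonneg (s := Finset.range N) (f := fun z => |f z|)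
      (fun i _ => abs_nonneg _)
    linarith

lemma integrable_of_bounded_nat (μ : Measure ℕ) [IsFiniteMeasure μ] {f : ℕ → ℝ}
    (h : ∃ C, ∀ z, |f z| ≤ C) : Integrable f μ := by
  obtain ⟨C, hC⟩ := h
  exact Integrable.of_bound (measurable_of_countable f).aestronglyMeasurable C
    (Eventually.of_forall hC)

lemma gwQRefl_eq_zero_of_eventually_const (p : ℕ → ℝ) {f : ℕ → ℝ} {N : ℕ} {c : ℝ}
    (h : ∀ z, N ≤ z → f z = c) {z : ℕ} (hz : N + 1 ≤ z) : gwQRefl p f z = 0 := by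
  unfold gwQRefl
  have : ∀ k : ℕ, (z : ℝ) * p k * (if 1 ≤ z + k - 1 then f (z + k - 1) - f z else 0) = 0 := by
    intro k
    rw [h z (by omega), h (z + k - 1) (by omega)]
    simp
  simp [this]

/-- If a smooth time-dependent observable, constant in space from `N` on, satisfies
`(∂ₛ + Q̃) g ≤ 0` on `[a, b]`, then it decreases in mean along the semigroup. -/
lemma integral_le_of_deriv_add_gwQRefl_nonpos (p : ℕ → ℝ) (R : MarkovSemigroup ℕ)
    (hR : IsReflSemigroup p R) {a b c : ℝ} {N : ℕ} {g g' : ℝ → ℕ → ℝ}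
    (hg : ∀ s ∈ Icc a b, ∀ z, N ≤ z → g s z = c)
    (hg' : ∀ s ∈ Icc a b, ∀ z, N ≤ z → g' s z = 0)
    (hd : ∀ s ∈ Icc a b, ∀ z, HasDerivAt (fun r => g r z) (g' s z) s)
    (hle : ∀ s ∈ Icc a b, ∀ z, g' s z + gwQRefl p (g s) z ≤ 0)
    {t : ℝ} (ht : t ∈ Icc a b) (x : ℕ) :
    ∫ y, g t y ∂ R.P (t - a) x ≤ g a x := by
  have hprob := R.prob
  have hab : a ≤ b := ht.1.trans ht.2
  set q : ℕ → ℝ → ℝ := fun z u => ∫ y, ({z} : Set ℕ).indicator 1 y ∂ R.P u x with hq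
  set q' : ℕ → ℝ → ℝ :=
    fun z u => ∫ y, gwQRefl p (({z} : Set ℕ).indicator 1) y ∂ R.P u x with hq'
  have hqd : ∀ z u, 0 ≤ u → HasDerivWithinAt (q z) (q' z u) (Ici 0) u := by
    intro z u hu
    refine hR _ ⟨1, fun y => ?_⟩ x u hu
    by_cases hy : y = z <;> simp [Set.indicator, hy]
  have hsum : ∀ u, 0 ≤ u → ∀ s ∈ Icc a b,
      ∑ z ∈ Finset.range N, (g s z - c) * q' z u = ∫ y, gwQRefl p (g s) y ∂ R.P u x := by
    intro u hu s hs
    have h1 := hR (g s) (bounded_of_eventually_const (hg s hs)) x u hu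
    have h2 : HasDerivWithinAt (fun u => c + ∑ z ∈ Finset.range N, (g s z - c) * q z u)
        (∑ z ∈ Finset.range N, (g s z - c) * q' z u) (Ici 0) u :=
      (HasDerivWithinAt.fun_sum fun z _ => (hqd z u hu).const_mul _).const_add c
    have h3 : (fun u => ∫ y, g s y ∂ R.P u x)
        = fun u => c + ∑ z ∈ Finset.range N, (g s z - c) * q z u := by
      funext u
      exact integral_of_eventually_const _ _ N c (hg s hs)
    rw [h3] at h1
    exact (uniqueDiffOn_Ici (0 : ℝ) u hu).eq_deriv _ h2 h1
  set D : ℝ → ℝ := fun u => c + ∑ z ∈ Finset.range N, (g (a + u) z - c) * q z u with hD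
  have hmem : ∀ u ∈ Icc 0 (b - a), a + u ∈ Icc a b := fun u hu =>
    ⟨by linarith [hu.1], by linarith [hu.2]⟩
  have hDd : ∀ u ∈ Icc 0 (b - a), HasDerivWithinAt D
      (∑ z ∈ Finset.range N, (g' (a + u) z * q z u + (g (a + u) z - c) * q' z u))
      (Icc 0 (b - a)) u := by
    intro u hu
    refine (HasDerivWithinAt.fun_sum fun z _ => ?_).const_add c
    have h1 : HasDerivAt (fun r => g (a + r) z - c) (g' (a + u) z) u :=
      ((hd _ (hmem u hu) z).comp_const_add a u).sub_const c
    exact h1.hasDerivWithinAt.mul ((hqd z u hu.1).mono Icc_subset_Ici_self)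
  have hneg : ∀ u ∈ Icc 0 (b - a),
      ∑ z ∈ Finset.range N, (g' (a + u) z * q z u + (g (a + u) z - c) * q' z u) ≤ 0 := by
    intro u hu
    have hs := hmem u hu
    have h1 : ∫ y, g' (a + u) y ∂ R.P u x = ∑ z ∈ Finset.range N, g' (a + u) z * q z u := by
      rw [integral_of_eventually_const _ _ N 0 (hg' _ hs)]
      simp [hq]
    rw [Finset.sum_add_distrib, hsum u hu.1 _ hs, ← h1, ← integral_add]
    · exact integral_nonpos fun y => hle _ hs y
    · exact integrable_of_bounded_nat _ (bounded_of_eventually_const (hg' _ hs))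
    · exact integrable_of_bounded_nat _ (bounded_of_eventually_const (N := N + 1)
        fun z hz => gwQRefl_eq_zero_of_eventually_const p (hg _ hs) hz)
  have hanti : AntitoneOn D (Icc 0 (b - a)) := by
    refine antitoneOn_of_hasDerivWithinAt_nonpos (convex_Icc _ _)
      (fun u hu => (hDd u hu).continuousWithinAt)
      (fun u hu => (hDd u (interior_subset hu)).mono interior_subset)
      (fun u hu => hneg u (interior_subset hu))
  have h0 := hanti (a := 0) (b := t - a) ⟨le_rfl, by linarith⟩
    ⟨by linarith [ht.1], by linarith [ht.2]⟩ (by linarith [ht.1])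
  have e1 : D (t - a) = ∫ y, g t y ∂ R.P (t - a) x := by
    rw [integral_of_eventually_const _ _ N c (hg t ht)]
    simp [hD, hq]
  have e0 : D 0 = g a x := by
    have : ∫ y, g a y ∂ R.P 0 x = D 0 := by
      rw [integral_of_eventually_const _ _ N c (hg a ⟨le_rfl, hab⟩)]
      simp [hD, hq]
    rw [← this, R.init, integral_dirac]
  rw [← e1, ← e0]
  exact h0

/-- Doob's maximal inequality for a nonnegative space-time supermartingale of a Markov process
observed at finitely many times. -/
lemma measureReal_exists_lt_mul_le {Ω : Type} [mΩ : MeasurableSpace Ω] (μ : Measure Ω)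
    [IsProbabilityMeasure μ] (R : MarkovSemigroup ℕ) (Z : ℝ → Ω → ℕ)
    (hmeas : ∀ t, Measurable (Z t))
    (hMarkov : ∀ s t : ℝ, 0 ≤ s → s ≤ t → ∀ f : ℕ → ℝ, Bounded f →
      (μ[(fun ω => f (Z t ω)) |
          ⨆ u ∈ Set.Icc (0:ℝ) s, MeasurableSpace.comap (Z u) inferInstance])
        =ᵐ[μ] fun ω => ∫ y, f y ∂ R.P (t - s) (Z s ω))
    {T G₀ L : ℝ} {g : ℝ → ℕ → ℝ} (h0 : ∀ ω, g 0 (Z 0 ω) ≤ G₀)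
    (hnn : ∀ s ∈ Icc 0 T, ∀ z, 0 ≤ g s z) (hb : ∀ s ∈ Icc 0 T, ∃ C, ∀ z, |g s z| ≤ C)
    (hsuper : ∀ s t, 0 ≤ s → s ≤ t → t ≤ T → ∀ x, ∫ y, g t y ∂ R.P (t - s) x ≤ g s x)
    {h : ℝ} (hh : 0 ≤ h) (A : ℝ → Set ℕ) (hA : ∀ s ∈ Icc 0 T, ∀ z ∈ A s, L ≤ g s z)
    (n : ℕ) (hn : n * h ≤ T) :
    μ.real {ω | ∃ k ≤ n, Z (k * h) ω ∈ A (k * h)} * L ≤ G₀ := by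
  have hmem : ∀ k : ℕ, k ≤ n → (k : ℝ) * h ∈ Icc 0 T := fun k hk =>
    ⟨by positivity, (mul_le_mul_of_nonneg_right (by exact_mod_cast hk) hh).trans hn⟩
  set E : ℕ → Set Ω := fun m => {ω | ∃ k ≤ m, Z (k * h) ω ∈ A (k * h)} with hE
  have hEm' : ∀ m : ℕ, MeasurableSet[⨆ u ∈ Set.Icc (0:ℝ) (m * h),
      MeasurableSpace.comap (Z u) inferInstance] (E m) := by
    intro m
    have : E m = ⋃ k ∈ Finset.range (m + 1), Z (k * h) ⁻¹' A (k * h) := by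
      ext ω
      simp [hE]
    rw [this]
    refine Finset.measurableSet_biUnion _ fun k hk => ?_
    have hk' : (k : ℝ) * h ∈ Icc (0 : ℝ) (m * h) :=
      ⟨by positivity, mul_le_mul_of_nonneg_right
        (by exact_mod_cast Nat.lt_succ_iff.1 (Finset.mem_range.1 hk)) hh⟩
    have hle : MeasurableSpace.comap (Z (k * h)) inferInstance ≤
        ⨆ u ∈ Set.Icc (0:ℝ) (m * h), MeasurableSpace.comap (Z u) inferInstance :=
      le_iSup₂_of_le (f := fun u (_ : u ∈ Set.Icc (0:ℝ) (m * h)) =>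
        MeasurableSpace.comap (Z u) inferInstance) _ hk' le_rfl
    exact hle _ ⟨A (k * h), MeasurableSet.of_discrete, rfl⟩
  have hsub : ∀ m : ℕ, (⨆ u ∈ Set.Icc (0:ℝ) (m * h),
      MeasurableSpace.comap (Z u) inferInstance) ≤ mΩ := fun m =>
    iSup₂_le fun u _ => (hmeas u).comap_le
  have hEm : ∀ m, MeasurableSet (E m) := fun m => hsub m _ (hEm' m)
  have hint : ∀ k : ℕ, k ≤ n → Integrable (fun ω => g (k * h) (Z (k * h) ω)) μ := by
    intro k hk
    obtain ⟨C, hC⟩ := hb _ (hmem k hk)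
    exact Integrable.of_bound
      ((measurable_of_countable (g (k * h))).comp (hmeas _)).aestronglyMeasurable C
      (Eventually.of_forall fun ω => hC _)
  have key : ∀ m : ℕ, m ≤ n →
      μ.real (E m) * L + ∫ ω in (E m)ᶜ, g (m * h) (Z (m * h) ω) ∂μ ≤ G₀ := by
    intro m
    induction m with
    | zero =>
      intro hm
      have h1 : μ.real (E 0) * L ≤ ∫ ω in E 0, g ((0 : ℕ) * h) (Z ((0 : ℕ) * h) ω) ∂μ := by
        rw [mul_comm]
        refine setIntegral_ge_of_const_le_real (hEm 0) (measure_ne_top _ _) ?_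
          (hint 0 hm).integrableOn
        rintro ω ⟨k, hk, hω⟩
        obtain rfl : k = 0 := by omega
        exact hA _ (hmem _ hm) _ hω
      have h2 := integral_add_compl (hEm 0) (hint 0 hm)
      have h3 : ∫ ω, g ((0 : ℕ) * h) (Z ((0 : ℕ) * h) ω) ∂μ ≤ G₀ := by
        have := integral_mono (hint 0 hm) (integrable_const G₀)
          (fun ω => by simpa using h0 ω)
        simpa using this
      linarith
    | succ m ih =>
      intro hm
      have ihm := ih (by omega)
      set X : Ω → ℝ := fun ω => g ((m + 1 : ℕ) * h) (Z ((m + 1 : ℕ) * h) ω) with hX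
      have hXi : Integrable X μ := hint (m + 1) hm
      have hsubset : E m ⊆ E (m + 1) := by
        rintro ω ⟨k, hk, hω⟩
        exact ⟨k, by omega, hω⟩
      have hstep : (m : ℝ) * h ≤ (m + 1 : ℕ) * h := by
        push_cast
        nlinarith
      have hcond : ∫ ω in (E m)ᶜ, X ω ∂μ ≤ ∫ ω in (E m)ᶜ, g (m * h) (Z (m * h) ω) ∂μ := by
        rw [← setIntegral_condExp (hsub m) hXi (hEm' m).compl]
        refine integral_mono_ae integrable_condExp.integrableOn
          (hint m (by omega)).integrableOn ?_
        refine ae_restrict_of_ae ?_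
        filter_upwards [hMarkov (m * h) ((m + 1 : ℕ) * h) (by positivity) hstep _
          (hb _ (hmem _ hm))] with ω hω
        rw [hω]
        exact hsuper _ _ (by positivity) hstep (hmem _ hm).2 _
      have hnew : μ.real (E (m + 1) \ E m) * L ≤ ∫ ω in E (m + 1) \ E m, X ω ∂μ := by
        rw [mul_comm]
        refine setIntegral_ge_of_const_le_real ((hEm _).diff (hEm _)) (measure_ne_top _ _) ?_
          hXi.integrableOn
        rintro ω ⟨⟨k, hk, hω⟩, hnot⟩
        have : k = m + 1 := by
          by_contra hne
          exact hnot ⟨k, by omega, hω⟩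
        subst this
        exact hA _ (hmem _ hm) _ hω
      have hsplit : ∫ ω in (E m)ᶜ, X ω ∂μ
          = ∫ ω in E (m + 1) \ E m, X ω ∂μ + ∫ ω in (E (m + 1))ᶜ, X ω ∂μ := by
        rw [← setIntegral_union _ (hEm _).compl hXi.integrableOn hXi.integrableOn]
        · congr 2
          ext ω
          have := @hsubset ω
          simp only [mem_compl_iff, mem_union, Set.mem_sdiff]
          tauto
        · exact disjoint_left.2 fun ω h1 h2 => h2 h1.1
      have hmeasure : μ.real (E (m + 1)) = μ.real (E m) + μ.real (E (m + 1) \ E m) := by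
        rw [measureReal_sdiff hsubset (hEm m) (measure_ne_top _ _)]
        ring
      rw [hmeasure]
      linarith
  have hfin := key n le_rfl
  have : 0 ≤ ∫ ω in (E n)ᶜ, g (n * h) (Z (n * h) ω) ∂μ :=
    integral_nonneg fun ω => hnn _ (hmem n le_rfl) _
  linarith

/-- A `C¹` concave nondecreasing truncation of the identity at level `K`. -/
def smoothTrunc (K y : ℝ) : ℝ := K / 2 - max (K - y) 0 ^ 2 / (2 * K)

/-- The derivative of `smoothTrunc K`. -/
def smoothTruncDeriv (K y : ℝ) : ℝ := max (K - y) 0 / K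

lemma hasDerivAt_max_zero_sq (x : ℝ) :
    HasDerivAt (fun y : ℝ => max y 0 ^ 2) (2 * max x 0) x := by
  rcases lt_trichotomy x 0 with hx | rfl | hx
  · rw [max_eq_right hx.le, mul_zero]
    refine (hasDerivAt_const x (0 : ℝ)).congr_of_eventuallyEq ?_
    filter_upwards [gt_mem_nhds hx] with y hy
    simp [max_eq_right (le_of_lt hy)]
  · rw [max_self, mul_zero, hasDerivAt_iff_isLittleO]
    have h1 : (fun y : ℝ => (y - 0) ^ 2) =o[𝓝 0] fun y : ℝ => y - 0 := by
      simpa using Asymptotics.isLittleO_pow_id (𝕜 := ℝ) (n := 2) (by norm_num)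
    refine Asymptotics.IsBigO.trans_isLittleO ?_ h1
    refine Asymptotics.IsBigO.of_bound 1 (Eventually.of_forall fun y => ?_)
    rcases le_total y 0 with hy | hy
    · simp [max_eq_right hy]
      positivity
    · simp [max_eq_left hy]
  · rw [max_eq_left hx.le]
    have h1 : HasDerivAt (fun y : ℝ => y ^ 2) (2 * x) x := by
      simpa using hasDerivAt_pow 2 x
    refine h1.congr_of_eventuallyEq ?_
    filter_upwards [lt_mem_nhds hx] with y hy
    simp [max_eq_left (le_of_lt hy)]

lemma hasDerivAt_smoothTrunc {K : ℝ} (hK : 0 < K) (y : ℝ) :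
    HasDerivAt (smoothTrunc K) (smoothTruncDeriv K y) y := by
  have h1 := ((hasDerivAt_max_zero_sq (K - y)).comp_const_sub K y)
  have h2 := (h1.div_const (2 * K)).const_sub (K / 2)
  have h3 : -(-(2 * max (K - y) 0) / (2 * K)) = smoothTruncDeriv K y := by
    unfold smoothTruncDeriv
    field_simp
  rw [← h3]
  exact h2

lemma smoothTruncDeriv_nonneg {K : ℝ} (hK : 0 < K) (y : ℝ) : 0 ≤ smoothTruncDeriv K y := by
  unfold smoothTruncDeriv
  positivity

lemma smoothTrunc_le_tangent {K : ℝ} (hK : 0 < K) (y y' : ℝ) :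
    smoothTrunc K y' ≤ smoothTrunc K y + smoothTruncDeriv K y * (y' - y) := by
  have key : max (K - y) 0 ^ 2 + 2 * max (K - y) 0 * (y - y') ≤ max (K - y') 0 ^ 2 := by
    rcases le_total (K - y) 0 with h | h <;> rcases le_total (K - y') 0 with h' | h' <;>
      simp only [max_eq_left h, max_eq_right h, max_eq_left h', max_eq_right h'] <;>
      nlinarith [sq_nonneg (y - y')]
  have h2 : smoothTrunc K y + smoothTruncDeriv K y * (y' - y) - smoothTrunc K y'
      = (max (K - y') 0 ^ 2 - (max (K - y) 0 ^ 2 + 2 * max (K - y) 0 * (y - y'))) / (2 * K) := by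
    unfold smoothTrunc smoothTruncDeriv
    field_simp
    ring
  have h3 : 0 ≤ smoothTrunc K y + smoothTruncDeriv K y * (y' - y) - smoothTrunc K y' := by
    rw [h2]
    exact div_nonneg (by linarith) (by linarith)
  linarith

lemma smoothTrunc_mono {K : ℝ} (hK : 0 < K) : Monotone (smoothTrunc K) := by
  intro y y' h
  have := smoothTrunc_le_tangent hK y' y
  nlinarith [smoothTruncDeriv_nonneg hK y', mul_nonneg (smoothTruncDeriv_nonneg hK y')
    (sub_nonneg.2 h)]

lemma smoothTrunc_zero {K : ℝ} (hK : 0 < K) : smoothTrunc K 0 = 0 := by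
  unfold smoothTrunc
  rw [sub_zero, max_eq_left hK.le]
  field_simp
  ring

lemma smoothTrunc_le_self {K : ℝ} (hK : 0 < K) (y : ℝ) : smoothTrunc K y ≤ y := by
  have := smoothTrunc_le_tangent hK 0 y
  rw [smoothTrunc_zero hK] at this
  have h1 : smoothTruncDeriv K 0 = 1 := by
    unfold smoothTruncDeriv
    rw [sub_zero, max_eq_left hK.le, div_self hK.ne']
  rw [h1] at this
  linarith

lemma sub_sq_div_le_smoothTrunc {K : ℝ} (hK : 0 < K) (y : ℝ) :
    y - y ^ 2 / (2 * K) ≤ smoothTrunc K y := by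
  have h1 : max (K - y) 0 ^ 2 ≤ (K - y) ^ 2 := by
    rcases le_total (K - y) 0 with h | h
    · rw [max_eq_right h]
      nlinarith [sq_nonneg (K - y)]
    · rw [max_eq_left h]
  have h2 : smoothTrunc K y - (y - y ^ 2 / (2 * K))
      = ((K - y) ^ 2 - max (K - y) 0 ^ 2) / (2 * K) := by
    unfold smoothTrunc
    field_simp
    ring
  have h3 : 0 ≤ smoothTrunc K y - (y - y ^ 2 / (2 * K)) := by
    rw [h2]
    exact div_nonneg (by linarith) (by linarith)
  linarith

lemma smoothTrunc_of_le {K y : ℝ} (h : K ≤ y) : smoothTrunc K y = K / 2 := by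
  simp [smoothTrunc, max_eq_right (sub_nonpos.2 h)]

lemma smoothTruncDeriv_of_le {K y : ℝ} (h : K ≤ y) : smoothTruncDeriv K y = 0 := by
  simp [smoothTruncDeriv, max_eq_right (sub_nonpos.2 h)]

lemma smoothTrunc_le_half {K : ℝ} (hK : 0 < K) (y : ℝ) : smoothTrunc K y ≤ K / 2 := by
  unfold smoothTrunc
  have : 0 ≤ max (K - y) 0 ^ 2 / (2 * K) := by positivity
  linarith

lemma abs_smoothTrunc_le {K : ℝ} (hK : 0 < K) {y : ℝ} (hy : 0 ≤ y) :
    |smoothTrunc K y| ≤ K / 2 := by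
  rw [abs_of_nonneg]
  · exact smoothTrunc_le_half hK y
  · rw [← smoothTrunc_zero hK]
    exact smoothTrunc_mono hK hy

lemma exp_sub_one_sub_self_le (y : ℝ) : Real.exp y - 1 - y ≤ y ^ 2 * Real.exp |y| := by
  have h1 : Real.exp y - 1 ≤ y * Real.exp y := by
    have := Real.add_one_le_exp (-y)
    have h2 := mul_le_mul_of_nonneg_right this (Real.exp_pos y).le
    rw [← Real.exp_add, neg_add_cancel, Real.exp_zero] at h2
    linarith
  rcases le_total 0 y with hy | hy
  · rw [abs_of_nonneg hy]
    have := mul_le_mul_of_nonneg_left h1 hy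
    nlinarith
  · have h3 : (1 : ℝ) ≤ Real.exp |y| := Real.one_le_exp (abs_nonneg y)
    have h4 := Real.add_one_le_exp y
    nlinarith [sq_nonneg y]

/-- Second order bound for the exponent of the Galton-Watson process. -/
lemma OffspringLaw.exists_exponent_bound {p : ℕ → ℝ} {σ v : ℝ} (hp : OffspringLaw p σ v) :
    ∃ C : ℝ, 0 < C ∧ ∀ θ : ℝ, 0 ≤ θ → θ ≤ v / C →
      (Summable fun k : ℕ => p k * (Real.exp (θ * ((k : ℝ) - 1)) - 1)) ∧
      ∑' k : ℕ, p k * (Real.exp (θ * ((k : ℝ) - 1)) - 1) ≤ -v * θ + C * θ ^ 2 := by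
  have hσ := hp.sigma_pos
  have hv := hp.v_pos
  have hnn := hp.nonneg
  have hsp : Summable p := by
    refine Summable.of_nonneg_of_le hnn (fun k => ?_) hp.expMoment
    exact le_mul_of_one_le_right (hnn k) (Real.one_le_exp (by positivity))
  have hskp : Summable fun k : ℕ => ((k : ℝ) - 1) * p k := by
    have h1 : Summable fun k : ℕ => (k : ℝ) * p k := by
      refine Summable.of_nonneg_of_le (fun k => mul_nonneg (by positivity) (hnn k))
        (fun k => ?_) (hp.expMoment.mul_left (1 / σ))
      have := Real.add_one_le_exp (σ * k)
      have h2 : (k : ℝ) ≤ 1 / σ * Real.exp (σ * k) := by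
        rw [one_div, inv_mul_eq_div, le_div_iff₀ hσ]
        linarith
      calc (k : ℝ) * p k ≤ (1 / σ * Real.exp (σ * k)) * p k :=
            mul_le_mul_of_nonneg_right h2 (hnn k)
        _ = _ := by ring
    simpa [sub_mul] using h1.sub hsp
  set S := ∑' k : ℕ, p k * Real.exp (σ * k) with hS
  have hS0 : 0 ≤ S := tsum_nonneg fun k => mul_nonneg (hnn k) (Real.exp_pos _).le
  set B : ℝ := 8 / σ ^ 2 * Real.exp σ with hB
  have hB0 : 0 < B := by positivity
  refine ⟨max (B * S) (2 * v / σ), lt_max_of_lt_right (by positivity), fun θ h0 hθ => ?_⟩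
  have hθσ : θ ≤ σ / 2 := by
    refine hθ.trans ?_
    rw [div_le_iff₀ (lt_max_of_lt_right (by positivity))]
    calc v = σ / 2 * (2 * v / σ) := by field_simp
      _ ≤ _ := mul_le_mul_of_nonneg_left (le_max_right _ _) (by positivity)
  have hs1 : Summable fun k : ℕ => p k * (Real.exp (θ * ((k : ℝ) - 1)) - 1) := by
    have : Summable fun k : ℕ => p k * Real.exp (θ * ((k : ℝ) - 1)) := by
      refine Summable.of_nonneg_of_le (fun k => mul_nonneg (hnn k) (Real.exp_pos _).le)
        (fun k => mul_le_mul_of_nonneg_left (Real.exp_le_exp.2 ?_) (hnn k)) hp.expMoment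
      have : (0 : ℝ) ≤ k := Nat.cast_nonneg k
      nlinarith
    simpa [mul_sub] using this.sub hsp
  refine ⟨hs1, ?_⟩
  have hterm : ∀ k : ℕ, p k * (Real.exp (θ * ((k : ℝ) - 1)) - 1)
      ≤ θ * (((k : ℝ) - 1) * p k) + θ ^ 2 * B * (p k * Real.exp (σ * k)) := by
    intro k
    have hk : (0 : ℝ) ≤ k := Nat.cast_nonneg k
    have h1 := exp_sub_one_sub_self_le (θ * ((k : ℝ) - 1))
    have habs : |(k : ℝ) - 1| ≤ k + 1 := abs_le.2 ⟨by linarith, by linarith⟩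
    have h2 : Real.exp |θ * ((k : ℝ) - 1)| ≤ Real.exp (σ * (k + 1) / 2) := by
      refine Real.exp_le_exp.2 ?_
      rw [abs_mul, abs_of_nonneg h0]
      calc θ * |(k : ℝ) - 1| ≤ σ / 2 * (k + 1) :=
            mul_le_mul hθσ habs (abs_nonneg _) (by positivity)
        _ = _ := by ring
    have h3 : ((k : ℝ) - 1) ^ 2 ≤ 8 / σ ^ 2 * Real.exp (σ * (k + 1) / 2) := by
      have h4 := Real.quadratic_le_exp_of_nonneg (x := σ * (k + 1) / 2) (by positivity)
      have h5 : (σ * ((k : ℝ) + 1) / 2) ^ 2 / 2 ≤ Real.exp (σ * (k + 1) / 2) := by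
        have : 0 ≤ σ * ((k : ℝ) + 1) / 2 := by positivity
        linarith
      calc ((k : ℝ) - 1) ^ 2 ≤ ((k : ℝ) + 1) ^ 2 := by nlinarith
        _ = 8 / σ ^ 2 * ((σ * ((k : ℝ) + 1) / 2) ^ 2 / 2) := by
          field_simp
          norm_num
        _ ≤ _ := mul_le_mul_of_nonneg_left h5 (by positivity)
    have h6 : (θ * ((k : ℝ) - 1)) ^ 2 * Real.exp |θ * ((k : ℝ) - 1)|
        ≤ θ ^ 2 * B * Real.exp (σ * k) := by
      calc (θ * ((k : ℝ) - 1)) ^ 2 * Real.exp |θ * ((k : ℝ) - 1)|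
          = θ ^ 2 * (((k : ℝ) - 1) ^ 2 * Real.exp |θ * ((k : ℝ) - 1)|) := by ring
        _ ≤ θ ^ 2 * ((8 / σ ^ 2 * Real.exp (σ * (k + 1) / 2)) * Real.exp (σ * (k + 1) / 2)) := by
          gcongr
        _ = θ ^ 2 * (8 / σ ^ 2 * (Real.exp (σ * (k + 1) / 2) * Real.exp (σ * (k + 1) / 2))) := by
          ring
        _ = θ ^ 2 * (8 / σ ^ 2 * (Real.exp σ * Real.exp (σ * k))) := by
          rw [← Real.exp_add, ← Real.exp_add]
          ring_nf
        _ = _ := by rw [hB]; ring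
    have h7 : Real.exp (θ * ((k : ℝ) - 1)) - 1
        ≤ θ * ((k : ℝ) - 1) + θ ^ 2 * B * Real.exp (σ * k) := by linarith
    calc _ ≤ p k * (θ * ((k : ℝ) - 1) + θ ^ 2 * B * Real.exp (σ * k)) :=
          mul_le_mul_of_nonneg_left h7 (hnn k)
      _ = _ := by ring
  have h8 := hs1.tsum_le_tsum hterm
    ((hskp.mul_left θ).add (hp.expMoment.mul_left (θ ^ 2 * B)))
  rw [(hskp.mul_left θ).tsum_add (hp.expMoment.mul_left (θ ^ 2 * B)), tsum_mul_left,
    tsum_mul_left, hp.drift] at h8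
  have h9 : B * S * θ ^ 2 ≤ max (B * S) (2 * v / σ) * θ ^ 2 :=
    mul_le_mul_of_nonneg_right (le_max_left _ _) (sq_nonneg θ)
  linarith

/-- The reflected generator applied to a truncated exponential. -/
lemma gwQRefl_smoothTrunc_exp_le {p : ℕ → ℝ} (hnn : ∀ k, 0 ≤ p k) (hsp : Summable p)
    {θ r : ℝ} (h0 : 0 ≤ θ)
    (hs : Summable fun k : ℕ => p k * (Real.exp (θ * ((k : ℝ) - 1)) - 1))
    {K : ℝ} (hK : 0 < K) (z : ℕ) :
    gwQRefl p (fun y => smoothTrunc K (Real.exp (θ * ((y : ℝ) - r)))) z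
      ≤ smoothTruncDeriv K (Real.exp (θ * ((z : ℝ) - r))) * Real.exp (θ * ((z : ℝ) - r)) *
        (z * ∑' k : ℕ, p k * (Real.exp (θ * ((k : ℝ) - 1)) - 1) + p 0 * θ) := by
  set F : ℕ → ℝ := fun y => Real.exp (θ * ((y : ℝ) - r)) with hF
  have hF0 : ∀ y, 0 < F y := fun y => Real.exp_pos _
  set d := smoothTruncDeriv K (F z) with hd
  have hd0 : 0 ≤ d := smoothTruncDeriv_nonneg hK _
  change gwQRefl p (fun y => smoothTrunc K (F y)) z ≤ d * F z * _
  rcases Nat.eq_zero_or_pos z with rfl | hz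
  · simp only [gwQRefl, Nat.cast_zero, zero_mul, tsum_zero, zero_add]
    exact mul_nonneg (mul_nonneg hd0 (hF0 _).le) (mul_nonneg (hnn 0) h0)
  have hshift : ∀ k : ℕ, F (z + k - 1) = F z * Real.exp (θ * ((k : ℝ) - 1)) := by
    intro k
    simp only [hF]
    rw [← Real.exp_add, Nat.cast_sub (by omega)]
    push_cast
    ring_nf
  have htan : ∀ k : ℕ, smoothTrunc K (F (z + k - 1)) - smoothTrunc K (F z)
      ≤ d * F z * (Real.exp (θ * ((k : ℝ) - 1)) - 1) := by
    intro k
    have := smoothTrunc_le_tangent hK (F z) (F (z + k - 1))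
    rw [hshift k] at this ⊢
    linarith
  have hterm : ∀ k : ℕ, (z : ℝ) * p k *
      (if 1 ≤ z + k - 1 then smoothTrunc K (F (z + k - 1)) - smoothTrunc K (F z) else 0)
      ≤ d * F z * z * (p k * (Real.exp (θ * ((k : ℝ) - 1)) - 1))
        + (if k = 0 then d * F z * (p 0 * θ) else 0) := by
    intro k
    have hzp : 0 ≤ (z : ℝ) * p k := mul_nonneg (Nat.cast_nonneg z) (hnn k)
    have hex : 0 ≤ d * F z * (p 0 * θ) :=
      mul_nonneg (mul_nonneg hd0 (hF0 _).le) (mul_nonneg (hnn 0) h0)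
    split_ifs with h1 h2 h2
    · have := mul_le_mul_of_nonneg_left (htan k) hzp
      linarith
    · have := mul_le_mul_of_nonneg_left (htan k) hzp
      linarith
    · subst h2
      obtain rfl : z = 1 := by omega
      have h3 := Real.add_one_le_exp (-θ)
      have h4 : 0 ≤ d * F 1 * p 0 := mul_nonneg (mul_nonneg hd0 (hF0 _).le) (hnn 0)
      have h5 : θ * (((0 : ℕ) : ℝ) - 1) = -θ := by push_cast; ring
      rw [h5]
      push_cast
      have := mul_le_mul_of_nonneg_left h3 h4
      linarith
    · omega
  have hs1 : Summable fun k : ℕ => (z : ℝ) * p k *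
      (if 1 ≤ z + k - 1 then smoothTrunc K (F (z + k - 1)) - smoothTrunc K (F z) else 0) := by
    refine Summable.of_norm_bounded (hsp.mul_left (z * K)) fun k => ?_
    have hzp : 0 ≤ (z : ℝ) * p k := mul_nonneg (Nat.cast_nonneg z) (hnn k)
    rw [norm_mul, Real.norm_of_nonneg hzp]
    have : ‖(if 1 ≤ z + k - 1 then smoothTrunc K (F (z + k - 1)) - smoothTrunc K (F z)
        else 0 : ℝ)‖ ≤ K := by
      split_ifs
      · have h1 := abs_smoothTrunc_le hK (hF0 (z + k - 1)).le
        have h2 := abs_smoothTrunc_le hK (hF0 z).le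
        have h3 := norm_sub_le (smoothTrunc K (F (z + k - 1))) (smoothTrunc K (F z))
        simp only [Real.norm_eq_abs] at h3 ⊢
        linarith
      · simpa using hK.le
    have := mul_le_mul_of_nonneg_left this hzp
    linarith
  have hs3 : HasSum (fun k : ℕ => if k = 0 then d * F z * (p 0 * θ) else 0)
      (d * F z * (p 0 * θ)) := by
    simpa using hasSum_ite_eq (0 : ℕ) (d * F z * (p 0 * θ))
  have h := hs1.tsum_le_tsum hterm ((hs.mul_left (d * F z * z)).add hs3.summable)
  rw [(hs.mul_left (d * F z * z)).tsum_add hs3.summable, tsum_mul_left, hs3.tsum_eq] at h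
  unfold gwQRefl
  linarith

lemma hasDerivAt_logistic {v C u₀ : ℝ} (hv : 0 < v) (hC : 0 < C) (hu : C / v ≤ u₀) (s : ℝ) :
    HasDerivAt (fun r => (C / v + (u₀ - C / v) * Real.exp (-v * r))⁻¹)
      (v * (C / v + (u₀ - C / v) * Real.exp (-v * s))⁻¹
        - C * ((C / v + (u₀ - C / v) * Real.exp (-v * s))⁻¹) ^ 2) s := by
  have hw : 0 < C / v + (u₀ - C / v) * Real.exp (-v * s) :=
    add_pos_of_pos_of_nonneg (by positivity)
      (mul_nonneg (sub_nonneg.2 hu) (Real.exp_pos _).le)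
  have h1 : HasDerivAt (fun r : ℝ => -v * r) (-v) s := by
    simpa using (hasDerivAt_id s).const_mul (-v)
  have h2 := ((h1.exp.const_mul (u₀ - C / v)).const_add (C / v)).inv hw.ne'
  refine h2.congr_deriv ?_
  set w := C / v + (u₀ - C / v) * Real.exp (-v * s) with hwd
  have h3 : (u₀ - C / v) * (Real.exp (-v * s) * -v) = -(v * w) + C := by
    rw [hwd]
    field_simp
    ring
  rw [h3]
  field_simp
  ring

/-- Truncated exponentials with a logistic parameter `θ` are space-time superharmonic for the
reflected Galton-Watson process. -/
lemma integral_smoothTrunc_exp_le {p : ℕ → ℝ} (hnn : ∀ k, 0 ≤ p k) (hsp : Summable p)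
    (R : MarkovSemigroup ℕ) (hR : IsReflSemigroup p R) {v C : ℝ} (hC : 0 < C)
    (hbound : ∀ θ : ℝ, 0 ≤ θ → θ ≤ v / C →
      (Summable fun k : ℕ => p k * (Real.exp (θ * ((k : ℝ) - 1)) - 1)) ∧
      ∑' k : ℕ, p k * (Real.exp (θ * ((k : ℝ) - 1)) - 1) ≤ -v * θ + C * θ ^ 2)
    {T θ₀ : ℝ} (hθ₀ : 0 < θ₀) {θ : ℝ → ℝ}
    (hθd : ∀ s ∈ Icc 0 T, HasDerivAt θ (v * θ s - C * θ s ^ 2) s)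
    (hθl : ∀ s ∈ Icc 0 T, θ₀ ≤ θ s) (hθu : ∀ s ∈ Icc 0 T, θ s ≤ v / C)
    {K : ℝ} (hK : 0 < K) {s t : ℝ} (hs : 0 ≤ s) (hst : s ≤ t) (ht : t ≤ T) (x : ℕ) :
    ∫ y, smoothTrunc K (Real.exp (θ t * ((y : ℝ) - p 0 * t))) ∂ R.P (t - s) x
      ≤ smoothTrunc K (Real.exp (θ s * ((x : ℝ) - p 0 * s))) := by
  obtain ⟨N, hN⟩ := exists_nat_ge (p 0 * T + K / θ₀)
  have hsubset : Icc s t ⊆ Icc 0 T := Icc_subset_Icc hs ht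
  have hlarge : ∀ r ∈ Icc s t, ∀ z : ℕ, N ≤ z →
      K ≤ Real.exp (θ r * ((z : ℝ) - p 0 * r)) := by
    intro r hr z hz
    have hr' := hsubset hr
    have h1 : (N : ℝ) ≤ z := by exact_mod_cast hz
    have h2 : p 0 * r ≤ p 0 * T := mul_le_mul_of_nonneg_left hr'.2 (hnn 0)
    have h3 : K / θ₀ ≤ (z : ℝ) - p 0 * r := by linarith
    have h4 : K ≤ θ r * ((z : ℝ) - p 0 * r) := by
      calc K = θ₀ * (K / θ₀) := by field_simp
        _ ≤ _ := mul_le_mul (hθl r hr') h3 (by positivity) (hθ₀.le.trans (hθl r hr'))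
    have := Real.add_one_le_exp (θ r * ((z : ℝ) - p 0 * r))
    linarith
  refine integral_le_of_deriv_add_gwQRefl_nonpos p R hR (a := s) (b := t) (c := K / 2) (N := N)
    (g := fun r y => smoothTrunc K (Real.exp (θ r * ((y : ℝ) - p 0 * r))))
    (g' := fun r y => smoothTruncDeriv K (Real.exp (θ r * ((y : ℝ) - p 0 * r))) *
      (Real.exp (θ r * ((y : ℝ) - p 0 * r)) *
        ((v * θ r - C * θ r ^ 2) * ((y : ℝ) - p 0 * r) + θ r * (-p 0))))
    ?_ ?_ ?_ ?_ ⟨hst, le_rfl⟩ x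
  · intro r hr z hz
    exact smoothTrunc_of_le (hlarge r hr z hz)
  · intro r hr z hz
    simp [smoothTruncDeriv_of_le (hlarge r hr z hz)]
  · intro r hr z
    have h1 : HasDerivAt (fun r : ℝ => (z : ℝ) - p 0 * r) (-p 0) r := by
      simpa using ((hasDerivAt_id r).const_mul (p 0)).const_sub (z : ℝ)
    exact (hasDerivAt_smoothTrunc hK _).comp r ((hθd r (hsubset hr)).mul h1).exp
  · intro r hr z
    have hr' := hsubset hr
    have h0 : 0 ≤ θ r := hθ₀.le.trans (hθl r hr')
    obtain ⟨hsum, hψ⟩ := hbound (θ r) h0 (hθu r hr')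
    have hQ := gwQRefl_smoothTrunc_exp_le hnn hsp (r := p 0 * r) h0 hsum hK z
    have hdF : 0 ≤ smoothTruncDeriv K (Real.exp (θ r * ((z : ℝ) - p 0 * r))) *
        Real.exp (θ r * ((z : ℝ) - p 0 * r)) :=
      mul_nonneg (smoothTruncDeriv_nonneg hK _) (Real.exp_pos _).le
    have hθ' : 0 ≤ v * θ r - C * θ r ^ 2 := by
      have h1 := (le_div_iff₀ hC).1 (hθu r hr')
      nlinarith
    have hz : (0 : ℝ) ≤ z := Nat.cast_nonneg z
    have h2 := mul_le_mul_of_nonneg_left hψ hz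
    have h3 : 0 ≤ (v * θ r - C * θ r ^ 2) * (p 0 * r) :=
      mul_nonneg hθ' (mul_nonneg (hnn 0) hr'.1)
    have h4 : (v * θ r - C * θ r ^ 2) * ((z : ℝ) - p 0 * r) + θ r * (-p 0)
        + (z * ∑' k : ℕ, p k * (Real.exp (θ r * ((k : ℝ) - 1)) - 1) + p 0 * θ r) ≤ 0 := by
      linarith
    have h5 := mul_nonpos_of_nonneg_of_nonpos hdF h4
    linarith

/-- If the truncated exponentials obey the maximal inequality at every truncation level, then so
does the exponential itself. -/
lemma mul_le_of_forall_mul_smoothTrunc_le {a L G : ℝ}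
    (h : ∀ K > 0, a * smoothTrunc K L ≤ G) (ha : 0 ≤ a) : a * L ≤ G := by
  have hlim : Tendsto (fun K : ℝ => a * (L - L ^ 2 / (2 * K))) atTop (𝓝 (a * (L - 0))) := by
    refine (tendsto_const_nhds.sub ?_).const_mul a
    exact tendsto_const_nhds.div_atTop (tendsto_id.const_mul_atTop two_pos)
  rw [sub_zero] at hlim
  refine le_of_tendsto hlim ?_
  filter_upwards [eventually_gt_atTop 0] with K hK
  exact (mul_le_mul_of_nonneg_left (sub_sq_div_le_smoothTrunc hK L) ha).trans (h K hK)

/-- A right-continuous `ℕ`-valued path that reaches a nonincreasing barrier before time `T` lies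
above it at a dyadic time. -/
lemma exists_dyadic_ge_barrier {T : ℝ} (hT : 0 < T) {z : ℝ → ℕ} {B : ℝ → ℝ} (hB : Antitone B)
    (hrc : ∀ t : ℝ, 0 ≤ t → ∃ ε > (0:ℝ), ∀ s ∈ Set.Ico t (t + ε), z s = z t)
    {s : ℝ} (hs : s ∈ Ico 0 T) (hz : B s ≤ z s) :
    ∃ n k : ℕ, k ≤ 2 ^ n ∧ B (k * (T / 2 ^ n)) ≤ z (k * (T / 2 ^ n)) := by
  obtain ⟨ε, hε, h⟩ := hrc s hs.1
  obtain ⟨n, hn⟩ := exists_pow_lt_of_lt_one (div_pos hε hT) (by norm_num : (1 / 2 : ℝ) < 1)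
  have hh : 0 < T / 2 ^ n := by positivity
  have hn' : T / 2 ^ n < ε := by
    rw [lt_div_iff₀ hT, one_div, inv_pow] at hn
    calc T / 2 ^ n = (2 ^ n)⁻¹ * T := by field_simp
      _ < ε := hn
  set k := ⌈s / (T / 2 ^ n)⌉₊ with hk
  have h1 : s ≤ k * (T / 2 ^ n) := (div_le_iff₀ hh).1 (Nat.le_ceil _)
  have h2 : k * (T / 2 ^ n) < s + ε := by
    have h3 := Nat.ceil_lt_add_one (div_nonneg hs.1 hh.le)
    have h4 := mul_lt_mul_of_pos_right h3 hh
    rw [add_mul, div_mul_cancel₀ _ hh.ne', one_mul, ← hk] at h4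
    linarith
  refine ⟨n, k, ?_, ?_⟩
  · refine Nat.ceil_le.2 ?_
    rw [div_le_iff₀ hh]
    push_cast
    rw [mul_div_cancel₀ _ (by positivity)]
    exact hs.2.le
  · rw [h _ ⟨h1, h2⟩]
    exact (hB h1).trans hz

/-- The logistic exponential is large whenever the path exceeds the mean by `δ`. -/
lemma logistic_exponent_lower_bound {c u₀ x δ E r z : ℝ} (hc : 0 < c) (hu : c ≤ u₀)
    (hx : 0 ≤ x) (hδ : 0 < δ) (hxu : 2 * (c * x) ≤ δ * u₀) (hE0 : 0 < E) (hE1 : E ≤ 1)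
    (hr : r ≤ δ / 4) (hz : δ + E * x ≤ z) :
    u₀⁻¹ * (x + δ / 4) ≤ (c + (u₀ - c) * E)⁻¹ * (z - r) := by
  have hu0 : 0 < u₀ := hc.trans_le hu
  have hw : 0 < c + (u₀ - c) * E :=
    add_pos_of_pos_of_nonneg hc (mul_nonneg (sub_nonneg.2 hu) hE0.le)
  rw [inv_mul_eq_div, inv_mul_eq_div, div_le_div_iff₀ hu0 hw]
  have h1 : (u₀ - c) * E ≤ u₀ - c := mul_le_of_le_one_right (sub_nonneg.2 hu) hE1
  have h2 : (3 * δ / 4 + E * x) * u₀ ≤ (z - r) * u₀ :=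
    mul_le_mul_of_nonneg_right (by linarith) hu0.le
  have h3 : x * (c * (1 - E)) ≤ x * c :=
    mul_le_mul_of_nonneg_left (by nlinarith) hx
  nlinarith [mul_le_mul_of_nonneg_left h1 hδ.le]

/-- **Large deviations for the reflected Galton-Watson process.**
There is a constant `κ > 0`, independent of `x`, such that for every
`T ≥ 1/(16v)` and every `δ ≥ max{1, 4Tp(0)}`,
`P(sup_{s<T}(Z̃^x_s - e^{-vs}x) ≥ δ) ≤ exp(-(κ/T) δ²/max{x,δ})`.
Here `Z` is a realization of the reflected Galton-Watson process: a
right-continuous Markov process with transition semigroup `R`. -/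
theorem gw_reflected_large_deviations
    (p : ℕ → ℝ) (σ v : ℝ) (hp : OffspringLaw p σ v)
    (W : MarkovSemigroup (ℕ × ℕ)) (hW : IsGWBSemigroup p W)
    (σ' : ℝ) (hσ' : 0 < σ') (hH : HMomentFinite W σ')
    (R : MarkovSemigroup ℕ) (hR : IsReflSemigroup p R)
    (Ω : Type) (mΩ : MeasurableSpace Ω) (μ : Measure Ω)
    (hμ : IsProbabilityMeasure μ)
    (Z : ℕ → ℝ → Ω → ℕ)
    (hmeas : ∀ x t, Measurable (Z x t))
    (hinit : ∀ x ω, Z x 0 ω = x)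
    (hrc : ∀ x ω, ∀ t : ℝ, 0 ≤ t →
      ∃ ε > (0:ℝ), ∀ s ∈ Set.Ico t (t + ε), Z x s ω = Z x t ω)
    (hMarkov : ∀ x : ℕ, ∀ s t : ℝ, 0 ≤ s → s ≤ t → ∀ f : ℕ → ℝ, Bounded f →
      (μ[(fun ω => f (Z x t ω)) |
          ⨆ u ∈ Set.Icc (0:ℝ) s, MeasurableSpace.comap (Z x u) inferInstance])
        =ᵐ[μ] fun ω => ∫ y, f y ∂ R.P (t - s) (Z x s ω)) :
    ∃ κ : ℝ, 0 < κ ∧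
      ∀ T : ℝ, 1 / (16 * v) ≤ T → ∀ δ : ℝ, max 1 (4 * T * p 0) ≤ δ →
        ∀ x : ℕ, 1 ≤ x →
          μ {ω | ∃ s ∈ Set.Ico (0:ℝ) T,
              δ ≤ (Z x s ω : ℝ) - Real.exp (-v * s) * (x : ℝ)}
            ≤ ENNReal.ofReal
                (Real.exp (-(κ / T) * δ ^ 2 / max (x : ℝ) δ)) := by
  obtain ⟨C, hC, hbound⟩ := hp.exists_exponent_bound
  have hv := hp.v_pos
  have hnn := hp.nonneg
  have hsp : Summable p := by
    by_contra hns
    have := hp.total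
    rw [tsum_eq_zero_of_not_summable hns] at this
    exact zero_ne_one this
  refine ⟨1 / (128 * C), by positivity, fun T hT δ hδ x hx => ?_⟩
  have hT0 : 0 < T := lt_of_lt_of_le (by positivity) hT
  have hδ1 : 1 ≤ δ := (le_max_left _ _).trans hδ
  have hδp : 4 * T * p 0 ≤ δ := (le_max_right _ _).trans hδ
  have hδ0 : 0 < δ := one_pos.trans_le hδ1
  set m := max (x : ℝ) δ with hm
  have hm0 : 0 < m := hδ0.trans_le (le_max_right _ _)
  set c := C / v with hc
  have hc0 : 0 < c := by positivity
  set u₀ := 2 * c * m / δ with hu₀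
  have hδu : δ * u₀ = 2 * c * m := by
    rw [hu₀]
    field_simp
  have hu0 : 0 < u₀ := by positivity
  have hcu : c ≤ u₀ := by
    rw [hu₀, le_div_iff₀ hδ0]
    have := mul_le_mul_of_nonneg_left (le_max_right (x : ℝ) δ) hc0.le
    have h2 : 0 < c * m := by positivity
    linarith
  have hxu : 2 * (c * x) ≤ δ * u₀ := by
    rw [hδu]
    have := mul_le_mul_of_nonneg_left (le_max_left (x : ℝ) δ) hc0.le
    linarith
  set θ : ℝ → ℝ := fun s => (c + (u₀ - c) * Real.exp (-v * s))⁻¹ with hθ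
  have hE1 : ∀ s ∈ Icc 0 T, Real.exp (-v * s) ≤ 1 := fun s hs =>
    Real.exp_le_one_iff.2 (by nlinarith [hs.1])
  have hθl : ∀ s ∈ Icc 0 T, u₀⁻¹ ≤ θ s := fun s hs => by
    have h1 : (u₀ - c) * Real.exp (-v * s) ≤ u₀ - c :=
      mul_le_of_le_one_right (sub_nonneg.2 hcu) (hE1 s hs)
    refine inv_anti₀ ?_ (by linarith)
    exact add_pos_of_pos_of_nonneg hc0 (mul_nonneg (sub_nonneg.2 hcu) (Real.exp_pos _).le)
  have hθu : ∀ s ∈ Icc 0 T, θ s ≤ v / C := fun s _ => by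
    have h1 : v / C = c⁻¹ := by rw [hc, inv_div]
    rw [h1]
    refine inv_anti₀ hc0 ?_
    have := mul_nonneg (sub_nonneg.2 hcu) (Real.exp_pos (-v * s)).le
    linarith
  set A : ℝ → Set ℕ := fun s => {z | δ + Real.exp (-v * s) * x ≤ z} with hA
  set E : ℕ → Set Ω :=
    fun n => {ω | ∃ k : ℕ, k ≤ 2 ^ n ∧ Z x (k * (T / 2 ^ n)) ω ∈ A (k * (T / 2 ^ n))} with hE
  have hgrid : ∀ n, μ.real (E n) ≤ Real.exp (-(u₀⁻¹ * (δ / 4))) := by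
    intro n
    have h1 : μ.real (E n) * Real.exp (u₀⁻¹ * (x + δ / 4)) ≤ Real.exp (u₀⁻¹ * x) := by
      refine mul_le_of_forall_mul_smoothTrunc_le (fun K hK => ?_) measureReal_nonneg
      refine measureReal_exists_lt_mul_le μ R (Z x) (hmeas x) (hMarkov x) (T := T)
        (g := fun s z => smoothTrunc K (Real.exp (θ s * ((z : ℝ) - p 0 * s))))
        ?_ ?_ ?_ ?_ (h := T / 2 ^ n) (by positivity) A ?_ (2 ^ n) ?_
      · intro ω
        refine (smoothTrunc_le_self hK _).trans (le_of_eq ?_)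
        simp [hθ, hinit]
      · intro s _ z
        rw [← smoothTrunc_zero hK]
        exact smoothTrunc_mono hK (Real.exp_pos _).le
      · exact fun s _ => ⟨K / 2, fun z => abs_smoothTrunc_le hK (Real.exp_pos _).le⟩
      · exact fun s t hs hst ht y => integral_smoothTrunc_exp_le hnn hsp R hR hC hbound
          (inv_pos.2 hu0) (fun r _ => hasDerivAt_logistic hv hC hcu r) hθl hθu hK hs hst ht y
      · intro s hs z hz
        refine smoothTrunc_mono hK (Real.exp_le_exp.2 ?_)
        refine logistic_exponent_lower_bound hc0 hcu (Nat.cast_nonneg x) hδ0 hxu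
          (Real.exp_pos _) (hE1 s hs) ?_ hz
        have := mul_le_mul_of_nonneg_left hs.2 (hnn 0)
        linarith
      · push_cast
        rw [mul_div_cancel₀ _ (by positivity)]
    rw [← le_div_iff₀ (Real.exp_pos _), ← Real.exp_sub] at h1
    refine h1.trans (le_of_eq ?_)
    congr 1
    ring
  have hEmono : Monotone E := by
    refine monotone_nat_of_le_succ fun n => ?_
    rintro ω ⟨k, hk, hω⟩
    refine ⟨2 * k, by rw [pow_succ]; omega, ?_⟩
    have : ((2 * k : ℕ) : ℝ) * (T / 2 ^ (n + 1)) = k * (T / 2 ^ n) := by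
      push_cast
      rw [pow_succ]
      field_simp
    rw [this]
    exact hω
  have hcover : {ω | ∃ s ∈ Set.Ico (0:ℝ) T,
      δ ≤ (Z x s ω : ℝ) - Real.exp (-v * s) * (x : ℝ)} ⊆ ⋃ n, E n := by
    rintro ω ⟨s, hs, hω⟩
    obtain ⟨n, k, hk, hz⟩ := exists_dyadic_ge_barrier hT0 (z := fun s => Z x s ω)
      (B := fun s => δ + Real.exp (-v * s) * x) (fun s t hst => by
        have : Real.exp (-v * t) ≤ Real.exp (-v * s) := Real.exp_le_exp.2 (by nlinarith)
        simp only
        gcongr) (hrc x ω) hs (by linarith)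
    exact mem_iUnion.2 ⟨n, k, hk, hz⟩
  have hexp : -(u₀⁻¹ * (δ / 4)) ≤ -(1 / (128 * C) / T) * δ ^ 2 / m := by
    have h1 : u₀⁻¹ * (δ / 4) = v / (8 * C) * (δ ^ 2 / m) := by
      rw [hu₀, hc]
      field_simp
      norm_num
    have h2 : 1 / (128 * C) / T ≤ v / (8 * C) := by
      have h3 := (div_le_iff₀ (by positivity)).1 hT
      rw [div_div, div_le_div_iff₀ (by positivity) (by positivity)]
      nlinarith
    have h4 := mul_le_mul_of_nonneg_right h2 (by positivity : 0 ≤ δ ^ 2 / m)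
    have h5 : -(1 / (128 * C) / T) * δ ^ 2 / m = -(1 / (128 * C) / T * (δ ^ 2 / m)) := by ring
    rw [h1, h5]
    linarith
  calc _ ≤ μ (⋃ n, E n) := measure_mono hcover
    _ = ⨆ n, μ (E n) := hEmono.measure_iUnion
    _ ≤ _ := iSup_le fun n => by
      rw [← ofReal_measureReal]
      exact ENNReal.ofReal_le_ofReal ((hgrid n).trans (Real.exp_le_exp.2 hexp))

end
end
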